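/- arXiv:1111.5403 — 3 statements merged into one kernel-verified Lean document; each statement's English description precedes it below -/
import Mathlib

section
/- For all sufficiently large real X and every θ with 1/10 ≤ θ ≤ 9/10, the number of positive integers n ≤ X with λ(n) ≤ X/exp((log X)^θ) is at most X/exp((log X)^(θ/3)). -/
open Filter

/-- Carmichael's function: the exponent of the multiplicative group `(ℤ/nℤ)ˣ`. -/
noncomputable def carmichael (n : ℕ) : ℕ :=
  Monoid.exponent (ZMod n)ˣ

section Aux

lemma aux_dvd {n p : ℕ} (hp : p.Prime) (hpn : p ∣ n) (hn : 0 < n) : p - 1 ∣ carmichael n := by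
  have h := ArithmeticFunction.carmichael_dvd hpn
  rw [ArithmeticFunction.carmichael_eq_exponent hn.ne',
    ArithmeticFunction.carmichael_eq_exponent hp.ne_zero] at h
  have : Fact p.Prime := ⟨hp⟩
  rw [IsCyclic.exponent_eq_card, Nat.card_eq_fintype_card, ZMod.card_units] at h
  exact h

lemma aux_pos {n : ℕ} (hn : 0 < n) : 0 < carmichael n := by
  have : NeZero n := ⟨hn.ne'⟩
  exact Nat.pos_of_ne_zero Monoid.exponent_ne_zero_of_finite

lemma aux_gcd_lcm (s : Finset ℕ) (f : ℕ → ℕ) (a : ℕ) :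
    Nat.gcd a (s.lcm f) ∣ ∏ q ∈ s, Nat.gcd a (f q) := by
  classical
  induction s using Finset.induction_on with
  | empty => simp
  | insert p s hp ih =>
    rw [Finset.prod_insert hp, Finset.lcm_insert]
    have h1 : Nat.gcd a (GCDMonoid.lcm (f p) (s.lcm f)) ∣ Nat.gcd a (f p * s.lcm f) :=
      Nat.gcd_dvd_gcd_of_dvd_right _ (Nat.lcm_dvd_mul _ _)
    exact h1.trans ((Nat.gcd_mul_right_dvd_mul_gcd a (f p) (s.lcm f)).trans
      (mul_dvd_mul_left _ ih))

lemma aux_prod_le (s : Finset ℕ) (f : ℕ → ℕ) (G : ℝ) (hG : 1 ≤ G)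
    (hf : ∀ p ∈ s, 0 < f p)
    (h : ∀ p ∈ s, ∀ q ∈ s, p ≠ q → (Nat.gcd (f p) (f q) : ℝ) ≤ G) :
    ((∏ p ∈ s, f p : ℕ) : ℝ) ≤ G ^ (s.card ^ 2) * (s.lcm f : ℕ) := by
  classical
  induction s using Finset.induction_on with
  | empty => simp
  | insert p s hp ih =>
    have ih' := ih (fun q hq => hf q (Finset.mem_insert_of_mem hq))
      (fun a ha b hb => h a (Finset.mem_insert_of_mem ha) b (Finset.mem_insert_of_mem hb))
    rw [Finset.prod_insert hp, Finset.lcm_insert, Finset.card_insert_of_notMem hp]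
    have e : Nat.gcd (f p) (s.lcm f) * Nat.lcm (f p) (s.lcm f) = f p * s.lcm f :=
      Nat.gcd_mul_lcm _ _
    have g1 : (Nat.gcd (f p) (s.lcm f) : ℝ) ≤ G ^ s.card := by
      have h1 : Nat.gcd (f p) (s.lcm f) ≤ ∏ q ∈ s, Nat.gcd (f p) (f q) :=
        Nat.le_of_dvd (Finset.prod_pos fun q _ =>
          Nat.gcd_pos_of_pos_left _ (hf p (Finset.mem_insert_self _ _))) (aux_gcd_lcm _ _ _)
      calc (Nat.gcd (f p) (s.lcm f) : ℝ) ≤ ((∏ q ∈ s, Nat.gcd (f p) (f q) : ℕ) : ℝ) := by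
            exact_mod_cast h1
        _ = ∏ q ∈ s, (Nat.gcd (f p) (f q) : ℝ) := by push_cast; rfl
        _ ≤ ∏ q ∈ s, G := Finset.prod_le_prod (fun _ _ => by positivity) (fun q hq =>
            h p (Finset.mem_insert_self _ _) q (Finset.mem_insert_of_mem hq)
              (fun hpq => hp (hpq ▸ hq)))
        _ = G ^ s.card := by simp
    have e' : (Nat.gcd (f p) (s.lcm f) : ℝ) * (Nat.lcm (f p) (s.lcm f) : ℝ)
        = (f p : ℝ) * (s.lcm f : ℕ) := by exact_mod_cast e
    have hG0 : (0 : ℝ) ≤ G := by linarith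
    calc ((f p * ∏ q ∈ s, f q : ℕ) : ℝ) = (f p : ℝ) * ((∏ q ∈ s, f q : ℕ) : ℝ) := by
          push_cast; rfl
      _ ≤ (f p : ℝ) * (G ^ (s.card ^ 2) * (s.lcm f : ℕ)) := by gcongr
      _ = G ^ (s.card ^ 2) * ((Nat.gcd (f p) (s.lcm f) : ℝ) * (Nat.lcm (f p) (s.lcm f) : ℝ)) := by
          rw [e']; ring
      _ ≤ G ^ (s.card ^ 2) * (G ^ s.card * (Nat.lcm (f p) (s.lcm f) : ℝ)) := by gcongr
      _ = G ^ (s.card ^ 2 + s.card) * (Nat.lcm (f p) (s.lcm f) : ℝ) := by rw [pow_add]; ring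
      _ ≤ G ^ ((s.card + 1) ^ 2) * (Nat.lcm (f p) (s.lcm f) : ℝ) := by
          have : s.card ^ 2 + s.card ≤ (s.card + 1) ^ 2 := by nlinarith
          gcongr

/-- Lower bound for the Carmichael function through a squarefree divisor. -/
lemma aux_lower {n m : ℕ} (hn : 0 < n) (hm : Squarefree m) (hmn : m ∣ n) (G : ℝ) (hG : 1 ≤ G)
    (h : ∀ p q : ℕ, p.Prime → q.Prime → p ∣ n → q ∣ n → p ≠ q →
      (Nat.gcd (p - 1) (q - 1) : ℝ) ≤ G) :
    (m : ℝ) ≤ 2 ^ n.primeFactors.card * G ^ (n.primeFactors.card ^ 2) * carmichael n := by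
  have hsub : m.primeFactors ⊆ n.primeFactors := Nat.primeFactors_mono hmn hn.ne'
  have hc := Finset.card_le_card hsub
  have h1 := aux_prod_le m.primeFactors (fun p => p - 1) G hG
    (fun p hp => by have := (Nat.prime_of_mem_primeFactors hp).two_le; show 0 < p - 1; omega)
    (fun p hp q hq hpq => h p q (Nat.prime_of_mem_primeFactors hp)
      (Nat.prime_of_mem_primeFactors hq) ((Nat.dvd_of_mem_primeFactors hp).trans hmn)
      ((Nat.dvd_of_mem_primeFactors hq).trans hmn) hpq)
  have h2 : m.primeFactors.lcm (fun p => p - 1) ≤ carmichael n :=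
    Nat.le_of_dvd (aux_pos hn) (Finset.lcm_dvd fun p hp =>
      aux_dvd (Nat.prime_of_mem_primeFactors hp) ((Nat.dvd_of_mem_primeFactors hp).trans hmn) hn)
  have h3 : m ≤ 2 ^ m.primeFactors.card * ∏ p ∈ m.primeFactors, (p - 1) := by
    conv_lhs => rw [← Nat.prod_primeFactors_of_squarefree hm]
    rw [← Finset.prod_const, ← Finset.prod_mul_distrib]
    refine Finset.prod_le_prod' fun p hp => ?_
    have := (Nat.prime_of_mem_primeFactors hp).two_le
    omega
  have h3' : (m : ℝ) ≤ 2 ^ m.primeFactors.card * ((∏ p ∈ m.primeFactors, (p - 1) : ℕ) : ℝ) := by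
    exact_mod_cast h3
  calc (m : ℝ) ≤ 2 ^ m.primeFactors.card * ((∏ p ∈ m.primeFactors, (p - 1) : ℕ) : ℝ) := h3'
    _ ≤ 2 ^ m.primeFactors.card * (G ^ (m.primeFactors.card ^ 2) *
        (m.primeFactors.lcm (fun p => p - 1) : ℕ)) := by gcongr
    _ ≤ 2 ^ n.primeFactors.card * (G ^ (n.primeFactors.card ^ 2) * (carmichael n : ℝ)) := by
        gcongr
        norm_num
    _ = _ := by ring

lemma aux_card_dvd (N d : ℕ) :
    (((Finset.Ioc 0 N).filter (fun n => d ∣ n)).card : ℝ) ≤ N / d := by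
  rw [Nat.Ioc_filter_dvd_card_eq_div]
  exact Nat.cast_div_le

open Classical in
/-- Few integers have a large square divisor. -/
lemma aux_count_sq (N : ℕ) (T : ℝ) (hT : 0 < T) :
    (((Finset.Ioc 0 N).filter (fun n => ∃ d : ℕ, T < d ∧ d ^ 2 ∣ n)).card : ℝ) ≤ N * (2 / T) := by
  classical
  have hsub : (Finset.Ioc 0 N).filter (fun n => ∃ d : ℕ, T < d ∧ d ^ 2 ∣ n) ⊆
      (Finset.Ioo ⌊T⌋₊ (N + 1)).biUnion
        (fun d => (Finset.Ioc 0 N).filter (fun n => d ^ 2 ∣ n)) := by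
    intro n hn
    simp only [Finset.mem_filter, Finset.mem_Ioc, Finset.mem_biUnion, Finset.mem_Ioo] at hn ⊢
    obtain ⟨⟨h0, h1⟩, d, hd, hdn⟩ := hn
    refine ⟨d, ⟨(Nat.floor_lt hT.le).2 hd, ?_⟩, ⟨h0, h1⟩, hdn⟩
    have := Nat.le_of_dvd h0 hdn
    have : d ≤ d ^ 2 := Nat.le_self_pow (by norm_num) d
    omega
  calc _ ≤ ((((Finset.Ioo ⌊T⌋₊ (N + 1)).biUnion
        (fun d => (Finset.Ioc 0 N).filter (fun n => d ^ 2 ∣ n))).card : ℕ) : ℝ) := by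
        exact_mod_cast Finset.card_le_card hsub
    _ ≤ ((∑ d ∈ Finset.Ioo ⌊T⌋₊ (N + 1),
        ((Finset.Ioc 0 N).filter (fun n => d ^ 2 ∣ n)).card : ℕ) : ℝ) := by
        exact_mod_cast Finset.card_biUnion_le
    _ = ∑ d ∈ Finset.Ioo ⌊T⌋₊ (N + 1),
        (((Finset.Ioc 0 N).filter (fun n => d ^ 2 ∣ n)).card : ℝ) := by push_cast; rfl
    _ ≤ ∑ d ∈ Finset.Ioo ⌊T⌋₊ (N + 1), (N : ℝ) * ((d : ℝ) ^ 2)⁻¹ := by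
        refine Finset.sum_le_sum fun d _ => (aux_card_dvd N (d ^ 2)).trans_eq ?_
        push_cast; rw [div_eq_mul_inv]
    _ ≤ N * (2 / (⌊T⌋₊ + 1)) := by
        rw [← Finset.mul_sum]; gcongr; exact sum_Ioo_inv_sq_le _ _
    _ ≤ N * (2 / T) := by
        gcongr; exact (Nat.lt_floor_add_one T).le

lemma aux_harm (N : ℕ) : ∑ a ∈ Finset.Icc 1 N, (a : ℝ)⁻¹ ≤ 1 + Real.log N := by
  have := harmonic_le_one_add_log N
  rw [harmonic_eq_sum_Icc] at this
  push_cast at this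
  exact this

open Classical in
/-- Few integers have two prime factors `p ≠ q` with large `gcd (p-1, q-1)`. -/
lemma aux_count_gcd (N : ℕ) (G : ℝ) (hG : 0 < G) :
    (((Finset.Ioc 0 N).filter (fun n => ∃ p q : ℕ, p.Prime ∧ q.Prime ∧ p ∣ n ∧ q ∣ n ∧ p ≠ q ∧
      G < (Nat.gcd (p - 1) (q - 1) : ℝ))).card : ℝ) ≤ N * (2 / G) * (1 + Real.log N) ^ 2 := by
  classical
  set I := Finset.Ioo ⌊G⌋₊ (N + 1) ×ˢ (Finset.Icc 1 N ×ˢ Finset.Icc 1 N) with hI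
  set F : ℕ × ℕ × ℕ → Finset ℕ := fun t =>
    (Finset.Ioc 0 N).filter (fun n => (t.1 * t.2.1 + 1) * (t.1 * t.2.2 + 1) ∣ n) with hF
  have hsub : (Finset.Ioc 0 N).filter (fun n => ∃ p q : ℕ, p.Prime ∧ q.Prime ∧ p ∣ n ∧ q ∣ n ∧
      p ≠ q ∧ G < (Nat.gcd (p - 1) (q - 1) : ℝ)) ⊆ I.biUnion F := by
    intro n hn
    simp only [Finset.mem_filter, Finset.mem_Ioc] at hn
    obtain ⟨⟨h0, h1⟩, p, q, hp, hq, hpn, hqn, hpq, hg⟩ := hn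
    obtain ⟨a, ha⟩ := Nat.gcd_dvd_left (p - 1) (q - 1)
    obtain ⟨b, hb⟩ := Nat.gcd_dvd_right (p - 1) (q - 1)
    set d := Nat.gcd (p - 1) (q - 1) with hd
    have hp2 := hp.two_le
    have hq2 := hq.two_le
    have hpN := Nat.le_of_dvd h0 hpn
    have hqN := Nat.le_of_dvd h0 hqn
    have ha0 : 0 < a := Nat.pos_of_ne_zero (by rintro rfl; simp at ha; omega)
    have hb0 : 0 < b := Nat.pos_of_ne_zero (by rintro rfl; simp at hb; omega)
    have hd0 : 0 < d := Nat.pos_of_ne_zero (by intro h; rw [h] at ha; simp at ha; omega)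
    have e1 : d ≤ d * a := Nat.le_mul_of_pos_right _ ha0
    have e2 : a ≤ d * a := Nat.le_mul_of_pos_left _ hd0
    have e3 : b ≤ d * b := Nat.le_mul_of_pos_left _ hd0
    simp only [Finset.mem_biUnion, hI, hF, Finset.mem_product, Finset.mem_Ioo, Finset.mem_Icc,
      Finset.mem_filter, Finset.mem_Ioc]
    refine ⟨(d, a, b), ⟨⟨(Nat.floor_lt hG.le).2 hg, by omega⟩, ⟨ha0, (by omega : a ≤ N)⟩,
      ⟨hb0, (by omega : b ≤ N)⟩⟩,
      ⟨h0, h1⟩, ?_⟩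
    have ep : d * a + 1 = p := by omega
    have eq : d * b + 1 = q := by omega
    show (d * a + 1) * (d * b + 1) ∣ n
    rw [ep, eq]
    exact ((Nat.coprime_primes hp hq).2 hpq).mul_dvd_of_dvd_of_dvd hpn hqn
  have hL := aux_harm N
  have hL0 : (0 : ℝ) ≤ ∑ a ∈ Finset.Icc 1 N, (a : ℝ)⁻¹ :=
    Finset.sum_nonneg fun _ _ => by positivity
  calc _ ≤ (((I.biUnion F).card : ℕ) : ℝ) := by exact_mod_cast Finset.card_le_card hsub
    _ ≤ ((∑ t ∈ I, (F t).card : ℕ) : ℝ) := by exact_mod_cast Finset.card_biUnion_le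
    _ = ∑ t ∈ I, ((F t).card : ℝ) := by push_cast; rfl
    _ ≤ ∑ t ∈ I, (N : ℝ) * (((t.1 : ℝ) ^ 2)⁻¹ * ((t.2.1 : ℝ)⁻¹ * (t.2.2 : ℝ)⁻¹)) := by
        refine Finset.sum_le_sum fun t ht => (aux_card_dvd N _).trans ?_
        simp only [hI, Finset.mem_product, Finset.mem_Ioo, Finset.mem_Icc] at ht
        obtain ⟨⟨h1, _⟩, ⟨h2, _⟩, ⟨h3, _⟩⟩ := ht
        have h1' : (0 : ℝ) < t.1 := by exact_mod_cast (by omega : 0 < t.1)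
        have h2' : (0 : ℝ) < t.2.1 := by exact_mod_cast h2
        have h3' : (0 : ℝ) < t.2.2 := by exact_mod_cast h3
        rw [div_eq_mul_inv, ← mul_inv, ← mul_inv]
        gcongr
        push_cast
        nlinarith [mul_pos h1' h2', mul_pos h1' h3']
    _ = N * ((∑ d ∈ Finset.Ioo ⌊G⌋₊ (N + 1), ((d : ℝ) ^ 2)⁻¹) *
        ((∑ a ∈ Finset.Icc 1 N, (a : ℝ)⁻¹) * ∑ a ∈ Finset.Icc 1 N, (a : ℝ)⁻¹)) := by
        rw [← Finset.mul_sum, hI, Finset.sum_mul_sum, ← Finset.sum_product', Finset.sum_mul_sum,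
          ← Finset.sum_product']
    _ ≤ N * ((2 / (⌊G⌋₊ + 1)) * ((1 + Real.log N) * (1 + Real.log N))) := by
        gcongr
        exact sum_Ioo_inv_sq_le _ _
    _ ≤ N * ((2 / G) * ((1 + Real.log N) * (1 + Real.log N))) := by
        have := hL0.trans hL
        gcongr
        exact (Nat.lt_floor_add_one G).le
    _ = _ := by ring

lemma aux_pow_omega (A n : ℕ) (hn : 0 < n) :
    (A + 1) ^ n.primeFactors.card ≤ ∑ d ∈ n.divisors, A ^ d.primeFactors.card := by
  classical
  have h := Finset.sum_pow_mul_eq_add_pow A 1 n.primeFactors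
  simp only [one_pow, mul_one] at h
  rw [← h]
  have hpf : ∀ s ∈ n.primeFactors.powerset, (∏ p ∈ s, p).primeFactors = s := by
    intro s hs
    exact Nat.primeFactors_prod fun p hp =>
      Nat.prime_of_mem_primeFactors (Finset.mem_powerset.1 hs hp)
  have hinj : Set.InjOn (fun s : Finset ℕ => ∏ p ∈ s, p) (n.primeFactors.powerset : Set _) := by
    intro s hs t ht hst
    rw [← hpf s hs, ← hpf t ht]
    exact congrArg _ hst
  calc ∑ s ∈ n.primeFactors.powerset, A ^ s.card
      = ∑ s ∈ n.primeFactors.powerset, A ^ (∏ p ∈ s, p).primeFactors.card :=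
        Finset.sum_congr rfl fun s hs => by rw [hpf s hs]
    _ = ∑ d ∈ n.primeFactors.powerset.image (fun s => ∏ p ∈ s, p), A ^ d.primeFactors.card :=
        (Finset.sum_image (f := fun d : ℕ => A ^ d.primeFactors.card) hinj).symm
    _ ≤ _ := by
        refine Finset.sum_le_sum_of_subset fun d hd => ?_
        obtain ⟨s, hs, rfl⟩ := Finset.mem_image.1 hd
        refine Nat.mem_divisors.2 ⟨?_, hn.ne'⟩
        exact (Finset.prod_dvd_prod_of_subset _ _ _ (Finset.mem_powerset.1 hs)).trans
          (Nat.prod_primeFactors_dvd n)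

lemma aux_moment (A N : ℕ) :
    ((∑ n ∈ Finset.Ioc 0 N, (A + 1) ^ n.primeFactors.card : ℕ) : ℝ) ≤
      N * (1 + Real.log N) ^ A := by
  induction A generalizing N with
  | zero => simp
  | succ A ih =>
    have h1 : ∑ n ∈ Finset.Ioc 0 N, (A + 1 + 1) ^ n.primeFactors.card ≤
        ∑ e ∈ Finset.Ioc 0 N, ∑ d ∈ Finset.Ioc 0 (N / e), (A + 1) ^ d.primeFactors.card := by
      calc _ ≤ ∑ n ∈ Finset.Ioc 0 N, ∑ d ∈ n.divisors, (A + 1) ^ d.primeFactors.card :=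
            Finset.sum_le_sum fun n hn => aux_pow_omega (A + 1) n (Finset.mem_Ioc.1 hn).1
        _ = ∑ n ∈ Finset.Ioc 0 N, ∑ x ∈ n.divisorsAntidiagonal, (A + 1) ^ x.2.primeFactors.card :=
            Finset.sum_congr rfl fun n _ => by
              rw [Nat.sum_divisorsAntidiagonal' (fun _ y => (A + 1) ^ y.primeFactors.card)]
        _ ≤ _ := by
            rw [Finset.sum_sigma', Finset.sum_sigma']
            refine le_of_eq ?_
            refine Finset.sum_bij' (fun x _ => ⟨x.2.1, x.2.2⟩)
              (fun y _ => ⟨y.1 * y.2, (y.1, y.2)⟩) ?_ ?_ ?_ ?_ ?_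
            · rintro ⟨n, e, d⟩ h
              simp only [Finset.mem_sigma, Finset.mem_Ioc, Nat.mem_divisorsAntidiagonal] at h ⊢
              obtain ⟨⟨h0, h1⟩, rfl, h3⟩ := h
              have he : 0 < e := Nat.pos_of_mul_pos_right h0
              have hd : 0 < d := Nat.pos_of_mul_pos_left h0
              refine ⟨⟨he, le_trans (Nat.le_mul_of_pos_right _ hd) h1⟩, hd, ?_⟩
              rw [Nat.le_div_iff_mul_le he, mul_comm]; exact h1
            · rintro ⟨e, d⟩ h
              simp only [Finset.mem_sigma, Finset.mem_Ioc, Nat.mem_divisorsAntidiagonal] at h ⊢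
              obtain ⟨⟨h0, h1⟩, h2, h3⟩ := h
              rw [Nat.le_div_iff_mul_le h0, mul_comm] at h3
              exact ⟨⟨Nat.mul_pos h0 h2, h3⟩, by simp, (Nat.mul_pos h0 h2).ne'⟩
            · rintro ⟨n, e, d⟩ h
              simp only [Finset.mem_sigma, Nat.mem_divisorsAntidiagonal] at h
              obtain ⟨_, rfl, _⟩ := h
              rfl
            · rintro ⟨e, d⟩ h
              rfl
            · rintro ⟨n, e, d⟩ h
              rfl
    rcases Nat.eq_zero_or_pos N with rfl | hN
    · simp
    have hlog : 0 ≤ Real.log N := Real.log_natCast_nonneg N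
    calc ((∑ n ∈ Finset.Ioc 0 N, (A + 1 + 1) ^ n.primeFactors.card : ℕ) : ℝ)
        ≤ ((∑ e ∈ Finset.Ioc 0 N, ∑ d ∈ Finset.Ioc 0 (N / e),
          (A + 1) ^ d.primeFactors.card : ℕ) : ℝ) := by exact_mod_cast h1
      _ = ∑ e ∈ Finset.Ioc 0 N, ((∑ d ∈ Finset.Ioc 0 (N / e),
          (A + 1) ^ d.primeFactors.card : ℕ) : ℝ) := by push_cast; rfl
      _ ≤ ∑ e ∈ Finset.Ioc 0 N, (N * (1 + Real.log N) ^ A) * (e : ℝ)⁻¹ := by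
          refine Finset.sum_le_sum fun e he => (ih (N / e)).trans ?_
          have he0 : 0 < e := (Finset.mem_Ioc.1 he).1
          have hdiv : 0 < N / e := Nat.div_pos (Finset.mem_Ioc.1 he).2 he0
          have hl : Real.log ((N / e : ℕ) : ℝ) ≤ Real.log N :=
            Real.log_le_log (by exact_mod_cast hdiv) (by exact_mod_cast Nat.div_le_self N e)
          have hl0 : 0 ≤ Real.log ((N / e : ℕ) : ℝ) := Real.log_natCast_nonneg _
          have hq : ((N / e : ℕ) : ℝ) ≤ N / e := Nat.cast_div_le
          calc ((N / e : ℕ) : ℝ) * (1 + Real.log ((N / e : ℕ) : ℝ)) ^ A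
              ≤ (N / e) * (1 + Real.log N) ^ A := by gcongr
            _ = _ := by rw [div_eq_mul_inv]; ring
      _ ≤ (N * (1 + Real.log N) ^ A) * (1 + Real.log N) := by
          rw [← Finset.mul_sum]
          gcongr
          exact aux_harm N
      _ = _ := by rw [pow_succ]; ring

open Classical in
/-- Few integers have many prime factors. -/
lemma aux_count_omega (N : ℕ) (D : ℝ) :
    (((Finset.Ioc 0 N).filter (fun n => D / 2 < (n.primeFactors.card : ℝ))).card : ℝ) ≤
      N * (1 + Real.log N) ^ 63 * Real.exp (-(2 * D)) := by
  have h := aux_moment 63 N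
  have hlow : (((Finset.Ioc 0 N).filter (fun n => D / 2 < (n.primeFactors.card : ℝ))).card : ℝ)
      * Real.exp (2 * D) ≤ ((∑ n ∈ Finset.Ioc 0 N, (63 + 1) ^ n.primeFactors.card : ℕ) : ℝ) := by
    rw [Nat.cast_sum, ← nsmul_eq_mul, ← Finset.sum_const]
    simp only [Nat.cast_pow, Nat.cast_add, Nat.cast_one, Nat.cast_ofNat]
    refine le_trans (Finset.sum_le_sum (g := fun n => ((63 : ℝ) + 1) ^ n.primeFactors.card) ?_)
      (Finset.sum_le_sum_of_subset_of_nonneg (Finset.filter_subset _ _)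
        (fun _ _ _ => by positivity))
    intro n hn
    have hD := (Finset.mem_filter.1 hn).2
    have h64 : Real.exp 4 ≤ (63 : ℝ) + 1 := by
      have h2 := Real.exp_one_lt_d9
      have : Real.exp 4 = Real.exp 1 ^ 4 := by rw [← Real.exp_nat_mul]; norm_num
      rw [this]
      calc Real.exp 1 ^ 4 ≤ 2.7182818286 ^ 4 := by gcongr
        _ ≤ 63 + 1 := by norm_num
    calc Real.exp (2 * D) ≤ Real.exp (n.primeFactors.card * 4) := by
          apply Real.exp_le_exp.2; linarith
      _ = Real.exp 4 ^ n.primeFactors.card := by rw [Real.exp_nat_mul]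
      _ ≤ _ := by gcongr
  have := hlow.trans h
  rw [Real.exp_neg, ← div_eq_mul_inv, le_div_iff₀ (Real.exp_pos _)]
  exact this

set_option maxHeartbeats 1000000 in
lemma aux_main (X D : ℝ) (hX : 1 ≤ X) (hD : 12 ≤ D)
    (hM : (1 + Real.log X) ^ 63 ≤ Real.exp (D / 2)) :
    (Nat.card {n : ℕ | 0 < n ∧ (n : ℝ) ≤ X ∧
      (carmichael n : ℝ) ≤ X / Real.exp (D ^ 3)} : ℝ) ≤ X / Real.exp D := by
  classical
  set N := ⌊X⌋₊ with hN
  have hX0 : 0 ≤ X := by linarith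
  have hNX : (N : ℝ) ≤ X := Nat.floor_le hX0
  have hN1 : 1 ≤ N := by rw [hN, Nat.one_le_floor_iff]; exact hX
  have hlogN0 : 0 ≤ Real.log N := Real.log_natCast_nonneg N
  have hlogX : Real.log N ≤ Real.log X := Real.log_le_log (by exact_mod_cast hN1) hNX
  have hL1 : 1 ≤ 1 + Real.log X := by linarith
  set G := Real.exp (3 * D) with hG
  have hG0 : 0 < G := Real.exp_pos _
  have hG1 : 1 ≤ G := Real.one_le_exp (by linarith)
  set S0 := Finset.Ioc 0 ⌊X / G⌋₊ with hS0
  set S1 := (Finset.Ioc 0 N).filter (fun n => ∃ d : ℕ, G < d ∧ d ^ 2 ∣ n) with hS1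
  set S2 := (Finset.Ioc 0 N).filter (fun n => D / 2 < (n.primeFactors.card : ℝ)) with hS2
  set S3 := (Finset.Ioc 0 N).filter (fun n => ∃ p q : ℕ, p.Prime ∧ q.Prime ∧ p ∣ n ∧ q ∣ n ∧
    p ≠ q ∧ G < (Nat.gcd (p - 1) (q - 1) : ℝ)) with hS3
  have hsub : {n : ℕ | 0 < n ∧ (n : ℝ) ≤ X ∧ (carmichael n : ℝ) ≤ X / Real.exp (D ^ 3)} ⊆
      ((S0 ∪ S1 ∪ S2 ∪ S3 : Finset ℕ) : Set ℕ) := by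
    rintro n ⟨h0, hnX, hc⟩
    by_contra hcon
    simp only [Finset.coe_union, Set.mem_union, Finset.mem_coe, not_or] at hcon
    obtain ⟨⟨⟨c0, c1⟩, c2⟩, c3⟩ := hcon
    have hnN : n ∈ Finset.Ioc 0 N := Finset.mem_Ioc.2 ⟨h0, Nat.le_floor hnX⟩
    have k0 : X / G < n := by
      by_contra hle
      exact c0 (Finset.mem_Ioc.2 ⟨h0, Nat.le_floor (not_lt.1 hle)⟩)
    have k1 : ∀ d : ℕ, d ^ 2 ∣ n → (d : ℝ) ≤ G := by
      intro d hd
      by_contra hlt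
      exact c1 (Finset.mem_filter.2 ⟨hnN, d, not_le.1 hlt, hd⟩)
    have k2 : (n.primeFactors.card : ℝ) ≤ D / 2 := by
      by_contra hlt
      exact c2 (Finset.mem_filter.2 ⟨hnN, not_le.1 hlt⟩)
    have k3 : ∀ p q : ℕ, p.Prime → q.Prime → p ∣ n → q ∣ n → p ≠ q →
        (Nat.gcd (p - 1) (q - 1) : ℝ) ≤ G := by
      intro p q hp hq hpn hqn hpq
      by_contra hlt
      exact c3 (Finset.mem_filter.2 ⟨hnN, p, q, hp, hq, hpn, hqn, hpq, not_le.1 hlt⟩)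
    obtain ⟨m, b, hbm, hm⟩ := Nat.sq_mul_squarefree n
    have hb := k1 b ⟨m, hbm.symm⟩
    have hlow := aux_lower h0 hm ⟨b ^ 2, by rw [← hbm]; ring⟩ G hG1 k3
    set w := n.primeFactors.card with hw
    have hw1 : (2 : ℝ) ^ w ≤ Real.exp (D / 2) := by
      have h2 : (2 : ℝ) ≤ Real.exp 1 := by have := Real.exp_one_gt_d9; linarith
      calc (2 : ℝ) ^ w ≤ Real.exp 1 ^ w := by gcongr
        _ = Real.exp (w * 1) := by rw [Real.exp_nat_mul]
        _ ≤ _ := Real.exp_le_exp.2 (by linarith)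
    have hw2 : G ^ (w ^ 2) ≤ Real.exp (3 / 4 * D ^ 3) := by
      rw [hG, ← Real.exp_nat_mul]
      apply Real.exp_le_exp.2
      push_cast
      have : (w : ℝ) ^ 2 ≤ (D / 2) ^ 2 := by gcongr
      nlinarith
    have hn : (n : ℝ) = b ^ 2 * m := by rw [← hbm]; push_cast; ring
    have hXn : X < Real.exp (9 * D + D / 2 + 3 / 4 * D ^ 3 - D ^ 3) * X := by
      calc X = X / G * G := by field_simp
        _ < n * G := by gcongr
        _ ≤ G ^ 2 * (Real.exp (D / 2) * Real.exp (3 / 4 * D ^ 3) *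
            (X / Real.exp (D ^ 3))) * G := by
            rw [hn]
            have : (m : ℝ) ≤ Real.exp (D / 2) * Real.exp (3 / 4 * D ^ 3) *
              (X / Real.exp (D ^ 3)) := hlow.trans (by gcongr)
            gcongr
        _ = _ := by
            rw [Real.exp_sub, Real.exp_add, Real.exp_add, hG,
              show 9 * D = 3 * D + 3 * D + 3 * D by ring, Real.exp_add, Real.exp_add]
            ring
    have hle : Real.exp (9 * D + D / 2 + 3 / 4 * D ^ 3 - D ^ 3) ≤ 1 := by
      rw [Real.exp_le_one_iff]
      nlinarith [mul_nonneg (by linarith : (0:ℝ) ≤ D) (by nlinarith : (0:ℝ) ≤ D ^ 2 - 144)]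
    exact absurd (hXn.trans_le (mul_le_of_le_one_left hX0 hle)) (lt_irrefl _)
  have hcard : (Nat.card {n : ℕ | 0 < n ∧ (n : ℝ) ≤ X ∧
      (carmichael n : ℝ) ≤ X / Real.exp (D ^ 3)} : ℝ) ≤
      (S0.card : ℝ) + S1.card + S2.card + S3.card := by
    have h1 : Nat.card {n : ℕ | 0 < n ∧ (n : ℝ) ≤ X ∧
        (carmichael n : ℝ) ≤ X / Real.exp (D ^ 3)} ≤ (S0 ∪ S1 ∪ S2 ∪ S3).card := by
      rw [Nat.card_coe_set_eq, ← Set.ncard_coe_finset]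
      exact Set.ncard_le_ncard hsub (Finset.finite_toSet _)
    have h2 : (S0 ∪ S1 ∪ S2 ∪ S3).card ≤ S0.card + S1.card + S2.card + S3.card := by
      have a1 := Finset.card_union_le (S0 ∪ S1 ∪ S2) S3
      have a2 := Finset.card_union_le (S0 ∪ S1) S2
      have a3 := Finset.card_union_le S0 S1
      omega
    exact_mod_cast h1.trans h2
  set E := Real.exp (D / 2) with hE
  have hE0 : 0 < E := Real.exp_pos _
  have hE7 : 7 ≤ E := by
    have := Real.add_one_le_exp (D / 2); linarith
  have eG : G = E ^ 6 := by rw [hG, hE, ← Real.exp_nat_mul]; congr 1; push_cast; ring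
  have eD : Real.exp D = E ^ 2 := by rw [hE, ← Real.exp_nat_mul]; congr 1; push_cast; ring
  have e4 : Real.exp (-(2 * D)) = 1 / E ^ 4 := by
    rw [Real.exp_neg, hE, ← Real.exp_nat_mul, one_div]; congr 2; push_cast; ring
  have b0 : (S0.card : ℝ) ≤ X / E ^ 6 := by
    rw [hS0, Nat.card_Ioc, ← eG]; exact Nat.floor_le (by positivity)
  have b1 : (S1.card : ℝ) ≤ X * (2 / E ^ 6) := by
    rw [← eG]; exact (aux_count_sq N G hG0).trans (by gcongr)
  have b2 : (S2.card : ℝ) ≤ X * E * (1 / E ^ 4) := by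
    rw [← e4]
    refine (aux_count_omega N D).trans ?_
    have : (1 + Real.log N) ^ 63 ≤ E := le_trans (by gcongr) hM
    gcongr
  have b3 : (S3.card : ℝ) ≤ X * (2 / E ^ 6) * E := by
    rw [← eG]
    refine (aux_count_gcd N G hG0).trans ?_
    have : (1 + Real.log N) ^ 2 ≤ E :=
      calc (1 + Real.log N) ^ 2 ≤ (1 + Real.log X) ^ 2 := by gcongr
        _ ≤ (1 + Real.log X) ^ 63 := pow_le_pow_right₀ hL1 (by norm_num)
        _ ≤ E := hM
    gcongr
  rw [eD]
  have key : X / E ^ 6 + X * (2 / E ^ 6) + X * E * (1 / E ^ 4) + X * (2 / E ^ 6) * E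
      ≤ X / E ^ 2 := by
    have : X / E ^ 6 + X * (2 / E ^ 6) + X * E * (1 / E ^ 4) + X * (2 / E ^ 6) * E
        = X * (3 + E ^ 3 + 2 * E) / E ^ 6 := by field_simp; ring
    rw [this, show X / E ^ 2 = X * E ^ 4 / E ^ 6 by field_simp]
    gcongr
    have h1 : 1 ≤ E ^ 3 := one_le_pow₀ (by linarith)
    have h2 : E ≤ E ^ 3 := le_self_pow₀ (by linarith) (by norm_num)
    nlinarith [mul_le_mul_of_nonneg_right hE7 (by linarith : (0:ℝ) ≤ E ^ 3)]
  linarith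

end Aux

theorem stmt8 :
    ∀ᶠ X : ℝ in atTop, ∀ θ : ℝ, 1 / 10 ≤ θ → θ ≤ 9 / 10 →
      (Nat.card {n : ℕ | 0 < n ∧ (n : ℝ) ≤ X ∧
          (carmichael n : ℝ) ≤ X / Real.exp (Real.log X ^ θ)} : ℝ) ≤
        X / Real.exp (Real.log X ^ (θ / 3)) := by
  have hlim : ∀ᶠ L : ℝ in atTop, 1 ≤ L ∧ 12 ≤ L ^ (1 / 30 : ℝ) ∧
      (1 + L) ^ 63 ≤ Real.exp (L ^ (1 / 30 : ℝ) / 2) := by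
    have t : Tendsto (fun L : ℝ => L ^ (1 / 30 : ℝ)) atTop atTop :=
      tendsto_rpow_atTop (by norm_num)
    have h3 : ∀ᶠ y : ℝ in atTop, (y ^ 31) ^ 63 ≤ Real.exp (y / 2) := by
      have h := (isLittleO_pow_exp_pos_mul_atTop (k := 31 * 63) (b := 1 / 2) (by norm_num)).bound
        (c := 1) one_pos
      filter_upwards [h, eventually_ge_atTop 0] with y hy hy0
      rw [Real.norm_of_nonneg (by positivity), Real.norm_of_nonneg (by positivity), one_mul,
        pow_mul] at hy
      exact hy.trans_eq (by congr 1; ring)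
    filter_upwards [eventually_ge_atTop 1, t.eventually_ge_atTop 12, t.eventually h3]
      with L h1 h12 h
    refine ⟨h1, h12, le_trans ?_ h⟩
    set y := L ^ (1 / 30 : ℝ) with hy
    have hyL : L = y ^ 30 := by
      rw [hy, ← Real.rpow_natCast, ← Real.rpow_mul (by linarith)]; norm_num
    gcongr
    rw [pow_succ, ← hyL]
    nlinarith
  filter_upwards [Real.tendsto_log_atTop.eventually hlim, eventually_ge_atTop 1] with X hX hX1 θ h1 h2
  obtain ⟨hL, h12, hM⟩ := hX
  have hmono : Real.log X ^ (1 / 30 : ℝ) ≤ Real.log X ^ (θ / 3) :=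
    Real.rpow_le_rpow_of_exponent_le hL (by linarith)
  have hcube : Real.log X ^ θ = (Real.log X ^ (θ / 3)) ^ 3 := by
    rw [← Real.rpow_natCast, ← Real.rpow_mul (by linarith)]; congr 1; push_cast; ring
  rw [hcube]
  exact aux_main X _ hX1 (h12.trans hmono)
    (hM.trans (Real.exp_le_exp.2 (by linarith)))
end

section
/- There is an absolute constant C such that for all real X ≥ 3, the number of positive integers n ≤ X with Ω(φ(n)) ≥ 110·(log log X)² is at most C·X/(log X)³. -/
open ArithmeticFunction in
/-- The completely multiplicative function `z ^ Ω(n) * n ^ (-s)`. -/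
noncomputable def lpF (z s : ℝ) : ℕ →* ℝ where
  toFun n := if n = 0 then 0 else z ^ (cardFactors n) * (n : ℝ) ^ (-s)
  map_one' := by simp
  map_mul' a b := by
    by_cases ha : a = 0
    · simp [ha]
    by_cases hb : b = 0
    · simp [hb]
    simp only [ha, hb, mul_eq_zero, or_self, if_false]
    rw [cardFactors_mul ha hb, pow_add, Nat.cast_mul,
      Real.mul_rpow (Nat.cast_nonneg a) (Nat.cast_nonneg b)]
    ring

open ArithmeticFunction in
lemma lpF_apply (z s : ℝ) {n : ℕ} (hn : n ≠ 0) :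
    lpF z s n = z ^ (cardFactors n) * (n : ℝ) ^ (-s) := by
  simp [lpF, hn]

open ArithmeticFunction in
lemma lpF_prime (z s : ℝ) {p : ℕ} (hp : p.Prime) : lpF z s p = z * (p : ℝ) ^ (-s) := by
  rw [lpF_apply z s hp.ne_zero, cardFactors_apply_prime hp, pow_one]

lemma lpF_nonneg {z : ℝ} (hz : 0 ≤ z) (s : ℝ) (n : ℕ) : 0 ≤ lpF z s n := by
  by_cases hn : n = 0
  · simp [lpF, hn]
  · rw [lpF_apply z s hn]; positivity

lemma lp_x_le {s : ℝ} (hs : 1 < s) {p : ℕ} (hp : 1 ≤ p) : (p : ℝ) ^ (-s) ≤ 1 / p := by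
  have h1 : (1 : ℝ) ≤ p := by exact_mod_cast hp
  calc (p : ℝ) ^ (-s) ≤ (p : ℝ) ^ (-1 : ℝ) :=
        Real.rpow_le_rpow_of_exponent_le h1 (by linarith)
    _ = 1 / p := by rw [Real.rpow_neg_one]; simp

lemma lp_x_half {s : ℝ} (hs : 1 < s) {p : ℕ} (hp : p.Prime) : (p : ℝ) ^ (-s) ≤ 1 / 2 := by
  refine (lp_x_le hs hp.one_le).trans ?_
  have : (2 : ℝ) ≤ p := by exact_mod_cast hp.two_le
  exact one_div_le_one_div_of_le (by norm_num) this

lemma lpF_norm_lt {z s : ℝ} (hz : 0 ≤ z) (hz2 : z < 2) (hs : 1 < s) {p : ℕ} (hp : p.Prime) :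
    ‖lpF z s p‖ < 1 := by
  rw [Real.norm_of_nonneg (lpF_nonneg hz s p), lpF_prime z s hp]
  have h1 := lp_x_half hs hp
  have h0 : (0 : ℝ) ≤ (p : ℝ) ^ (-s) := by positivity
  nlinarith

lemma lp_factor {s : ℝ} (hs : 1 < s) {p : ℕ} (hp : p.Prime) :
    (1 - lpF (7/4) s p)⁻¹ ≤ (if p < 4 then (8 : ℝ) else 1) * ((1 - lpF 1 s p)⁻¹) ^ 2 := by
  rw [lpF_prime _ s hp, lpF_prime _ s hp]
  have h1 := lp_x_half hs hp
  have h0 : (0 : ℝ) ≤ (p : ℝ) ^ (-s) := by positivity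
  have h2 := lp_x_le hs hp.one_le
  set x := (p : ℝ) ^ (-s)
  have hpos : 0 < 1 - 7/4 * x := by linarith
  have hpos' : 0 < (1 - 1 * x) ^ 2 := by apply pow_pos; linarith
  rw [inv_pow, ← div_eq_mul_inv, inv_eq_one_div, div_le_div_iff₀ hpos hpos']
  split_ifs with h
  · nlinarith
  · have h4 : (4 : ℝ) ≤ p := by exact_mod_cast not_lt.mp h
    have : x ≤ 1 / 4 := h2.trans (one_div_le_one_div_of_le (by norm_num) h4)
    nlinarith

lemma lp_const (N : ℕ) : ∏ p ∈ N.primesBelow, (if p < 4 then (8 : ℝ) else 1) ≤ 64 := by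
  rw [Finset.prod_ite]
  simp only [Finset.prod_const, one_pow, mul_one]
  have hsub : N.primesBelow.filter (· < 4) ⊆ {2, 3} := by
    intro p hp
    rw [Finset.mem_filter, Nat.mem_primesBelow] at hp
    obtain ⟨⟨_, hp⟩, h4⟩ := hp
    have := hp.two_le
    simp; omega
  have hc := Finset.card_le_card hsub
  have h2 : ({2, 3} : Finset ℕ).card = 2 := by decide
  rw [h2] at hc
  calc (8 : ℝ) ^ _ ≤ 8 ^ 2 := pow_le_pow_right₀ (by norm_num) hc
    _ = 64 := by norm_num

lemma lp_prod_le {s : ℝ} (hs : 1 < s) (N : ℕ) :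
    ∏ p ∈ N.primesBelow, (1 - lpF 1 s p)⁻¹ ≤ ∑' n : ℕ, 1 / (n : ℝ) ^ s := by
  have h := (EulerProduct.summable_and_hasSum_smoothNumbers_prod_primesBelow_geometric
    (f := lpF 1 s) (fun hp => lpF_norm_lt (by norm_num) (by norm_num) hs hp) N)
  rw [← h.2.tsum_eq]
  have hsum : Summable (fun n : ℕ => 1 / (n : ℝ) ^ s) := Real.summable_one_div_nat_rpow.mpr hs
  have heq : (fun m : N.smoothNumbers => lpF 1 s m)
      = fun m : N.smoothNumbers => (fun n : ℕ => 1 / (n : ℝ) ^ s) m := by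
    funext m
    rw [lpF_apply _ _ (Nat.ne_zero_of_mem_smoothNumbers m.2), one_pow, one_mul,
      Real.rpow_neg (Nat.cast_nonneg _)]
    simp
  rw [heq]
  exact hsum.tsum_subtype_le _ _ (fun n => by positivity)

lemma lp_sum_le {s : ℝ} (hs : 1 < s) (N : ℕ) :
    ∑ n ∈ Finset.Icc 1 N, lpF (7/4) s n ≤ 64 * (∑' n : ℕ, 1 / (n : ℝ) ^ s) ^ 2 := by
  have h := (EulerProduct.summable_and_hasSum_smoothNumbers_prod_primesBelow_geometric
    (f := lpF (7/4) s) (fun hp => lpF_norm_lt (by norm_num) (by norm_num) hs hp) (N+1))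
  have h1 : ∑ n ∈ Finset.Icc 1 N, lpF (7/4) s n
      ≤ ∏ p ∈ (N+1).primesBelow, (1 - lpF (7/4) s p)⁻¹ := by
    have hmem : ∀ n ∈ Finset.Icc 1 N, n ∈ (N+1).smoothNumbers := by
      intro n hn
      rw [Finset.mem_Icc] at hn
      exact Nat.mem_smoothNumbers_of_lt (by omega) (by omega)
    have := sum_le_hasSum ((Finset.Icc 1 N).subtype (· ∈ (N+1).smoothNumbers))
      (fun i _ => lpF_nonneg (by norm_num) s i) h.2
    rwa [Finset.sum_subtype_of_mem (fun n => lpF (7/4) s n) hmem] at this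
  have hx : ∀ p ∈ (N+1).primesBelow, 0 ≤ (1 - lpF 1 s p)⁻¹ := by
    intro p hp
    have := lpF_norm_lt (z := 1) (by norm_num) (by norm_num) hs (Nat.prime_of_mem_primesBelow hp)
    rw [Real.norm_of_nonneg (lpF_nonneg (by norm_num) s p)] at this
    rw [inv_nonneg]; linarith
  have h2 : ∏ p ∈ (N+1).primesBelow, (1 - lpF (7/4) s p)⁻¹ ≤
      ∏ p ∈ (N+1).primesBelow,
        ((if p < 4 then (8 : ℝ) else 1) * ((1 - lpF 1 s p)⁻¹) ^ 2) := by
    apply Finset.prod_le_prod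
    · intro p hp
      have := lpF_norm_lt (z := 7/4) (by norm_num) (by norm_num) hs
        (Nat.prime_of_mem_primesBelow hp)
      rw [Real.norm_of_nonneg (lpF_nonneg (by norm_num) s p)] at this
      rw [inv_nonneg]; linarith
    · intro p hp
      exact lp_factor hs (Nat.prime_of_mem_primesBelow hp)
  rw [Finset.prod_mul_distrib, Finset.prod_pow] at h2
  refine h1.trans (h2.trans ?_)
  have h3 := Finset.prod_nonneg hx
  gcongr
  · exact lp_const _
  · exact lp_prod_le hs _

open ArithmeticFunction in
lemma lp_B : ∃ X₀ : ℝ, ∀ X : ℝ, X₀ ≤ X →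
    ∑ n ∈ Finset.Icc 1 ⌊X⌋₊, (7/4 : ℝ) ^ (cardFactors n) / n ≤ 768 * Real.log X ^ 2 := by
  have h1 := tendsto_sub_mul_tsum_nat_rpow.eventually (gt_mem_nhds (show (1:ℝ) < 2 by norm_num))
  have h2 : Filter.Tendsto (fun X : ℝ => 1 + (Real.log X)⁻¹) Filter.atTop (nhdsWithin 1 (Set.Ioi 1)) := by
    apply tendsto_nhdsWithin_iff.mpr
    constructor
    · have := (Filter.Tendsto.comp tendsto_inv_atTop_zero Real.tendsto_log_atTop).const_add 1
      simpa using this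
    · filter_upwards [Filter.eventually_gt_atTop 1] with X hX
      have := Real.log_pos hX
      simp [this]
  have h3 := (h2.eventually h1).and (Filter.eventually_ge_atTop 3)
  obtain ⟨X₀, hX₀⟩ := Filter.eventually_atTop.mp h3
  refine ⟨X₀, fun X hX => ?_⟩
  obtain ⟨hz, hX3⟩ := hX₀ X hX
  have hl : 0 < Real.log X := Real.log_pos (by linarith)
  set s := 1 + (Real.log X)⁻¹ with hs
  have hs1 : 1 < s := by
    have := inv_pos.mpr hl
    linarith
  have hZ : ∑' n : ℕ, 1 / (n : ℝ) ^ s ≤ 2 * Real.log X := by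
    have e : s - 1 = (Real.log X)⁻¹ := by rw [hs]; ring
    rw [e, inv_mul_lt_iff₀ hl] at hz
    linarith
  have hZ0 : 0 ≤ ∑' n : ℕ, 1 / (n : ℝ) ^ s := tsum_nonneg (fun n => by positivity)
  have hterm : ∀ n ∈ Finset.Icc 1 ⌊X⌋₊, (7/4 : ℝ) ^ (cardFactors n) / n ≤ 3 * lpF (7/4) s n := by
    intro n hn
    rw [Finset.mem_Icc] at hn
    have hn0 : n ≠ 0 := by omega
    have hn0' : (0:ℝ) < n := by exact_mod_cast (by omega : 0 < n)
    have hnX : (n : ℝ) ≤ X := (Nat.le_floor_iff (by linarith)).mp hn.2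
    rw [lpF_apply _ _ hn0]
    have e1 : (n : ℝ) ^ (-s) = (n:ℝ) ^ (-(Real.log X)⁻¹) / n := by
      rw [hs, neg_add, add_comm, ← sub_eq_add_neg, Real.rpow_sub_one hn0'.ne']
    have e2 : 1 ≤ 3 * (n:ℝ) ^ (-(Real.log X)⁻¹) := by
      rw [Real.rpow_neg hn0'.le, ← div_eq_mul_inv, le_div_iff₀ (by positivity), one_mul]
      calc (n:ℝ) ^ ((Real.log X)⁻¹) ≤ X ^ ((Real.log X)⁻¹) := by
            apply Real.rpow_le_rpow hn0'.le hnX (by positivity)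
        _ = Real.exp 1 := by
            rw [Real.rpow_def_of_pos (by linarith), mul_inv_cancel₀ hl.ne']
        _ ≤ 3 := by have := Real.exp_one_lt_d9; linarith
    rw [e1]
    have : 0 ≤ (7/4 : ℝ) ^ (cardFactors n) / n := by positivity
    calc (7/4 : ℝ) ^ (cardFactors n) / n = (7/4 : ℝ) ^ (cardFactors n) / n * 1 := by ring
      _ ≤ (7/4 : ℝ) ^ (cardFactors n) / n * (3 * (n:ℝ) ^ (-(Real.log X)⁻¹)) := by gcongr
      _ = _ := by ring
  calc _ ≤ ∑ n ∈ Finset.Icc 1 ⌊X⌋₊, 3 * lpF (7/4) s n := Finset.sum_le_sum hterm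
    _ = 3 * ∑ n ∈ Finset.Icc 1 ⌊X⌋₊, lpF (7/4) s n := by rw [Finset.mul_sum]
    _ ≤ 3 * (64 * (∑' n : ℕ, 1 / (n : ℝ) ^ s) ^ 2) := by gcongr; exact lp_sum_le hs1 _
    _ ≤ 3 * (64 * (2 * Real.log X) ^ 2) := by gcongr
    _ = _ := by ring

open ArithmeticFunction in
open Classical in
/-- The positive integers up to `X` with many prime factors. -/
noncomputable def lpS (X : ℝ) : Finset ℕ :=
  (Finset.Icc 1 ⌊X⌋₊).filter (fun n => 10 * Real.log (Real.log X) ≤ cardFactors n)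

open ArithmeticFunction in
lemma lp_C : ∃ X₀ : ℝ, ∀ X : ℝ, X₀ ≤ X →
    ∑ n ∈ lpS X, (1 : ℝ) / n ≤ 768 / Real.log X ^ 3 := by
  obtain ⟨X₀, h⟩ := lp_B
  refine ⟨max X₀ 3, fun X hX => ?_⟩
  have hX3 : 3 ≤ X := (le_max_right _ _).trans hX
  have hB := h X ((le_max_left _ _).trans hX)
  have hl : 1 ≤ Real.log X := by
    rw [Real.le_log_iff_exp_le (by linarith)]
    have := Real.exp_one_lt_d9; linarith
  have hlog : 1 / 2 ≤ Real.log (7/4) := by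
    have h1 : (1:ℝ) ≤ Real.log ((7/4)^2) := by
      rw [Real.le_log_iff_exp_le (by norm_num)]
      have := Real.exp_one_lt_d9; norm_num at this ⊢; linarith
    rw [Real.log_pow] at h1
    push_cast at h1; linarith
  have hL : 0 ≤ Real.log (Real.log X) := Real.log_nonneg hl
  have hterm : ∀ n ∈ lpS X, Real.log X ^ 5 * ((1 : ℝ) / n) ≤ (7/4 : ℝ) ^ (cardFactors n) / n := by
    intro n hn
    have hn2 := (Finset.mem_filter.mp hn).2
    have : Real.log X ^ 5 ≤ (7/4 : ℝ) ^ (cardFactors n) := by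
      rw [← Real.log_le_log_iff (by positivity) (by positivity), Real.log_pow, Real.log_pow]
      push_cast
      nlinarith
    rw [mul_one_div]
    gcongr
  have hsum : Real.log X ^ 5 * ∑ n ∈ lpS X, (1 : ℝ) / n ≤ 768 * Real.log X ^ 2 := by
    rw [Finset.mul_sum]
    refine (Finset.sum_le_sum hterm).trans (le_trans ?_ hB)
    apply Finset.sum_le_sum_of_subset_of_nonneg
    · exact Finset.filter_subset _ _
    · intro i _ _; positivity
  rw [le_div_iff₀ (by positivity)]
  have h2 : 0 < Real.log X ^ 2 := by positivity
  refine le_of_mul_le_mul_left ?_ h2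
  calc _ = Real.log X ^ 5 * ∑ n ∈ lpS X, (1 : ℝ) / n := by ring
    _ ≤ _ := by linarith

open ArithmeticFunction in
lemma lp_totient (K : ℝ) (hK : 1 ≤ K) (n : ℕ) (hn : n ≠ 0)
    (h : ∀ p : ℕ, p.Prime → p ∣ n → (cardFactors (p - 1) : ℝ) ≤ K) :
    (cardFactors n.totient : ℝ) ≤ K * cardFactors n := by
  induction n using induction_on_primes with
  | zero => exact absurd rfl hn
  | one => simp
  | prime_mul p a hp ih =>
    have ha : a ≠ 0 := by rintro rfl; simp at hn
    have hta : a.totient ≠ 0 := (Nat.totient_pos.mpr (Nat.pos_of_ne_zero ha)).ne'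
    have ih' := ih ha (fun q hq hqa => h q hq (hqa.mul_left p))
    rw [cardFactors_mul hp.ne_zero ha, cardFactors_apply_prime hp]
    by_cases hpa : p ∣ a
    · rw [Nat.totient_mul_of_prime_of_dvd hp hpa, cardFactors_mul hp.ne_zero hta,
        cardFactors_apply_prime hp]
      push_cast
      linarith
    · have hp1 : p - 1 ≠ 0 := by have := hp.two_le; omega
      rw [Nat.totient_mul_of_prime_of_not_dvd hp hpa, cardFactors_mul hp1 hta]
      have := h p hp (dvd_mul_right p a)
      push_cast
      linarith

open ArithmeticFunction in
lemma lp_main : ∃ X₀ : ℝ, ∀ X : ℝ, X₀ ≤ X →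
      (Nat.card {n : ℕ | 0 < n ∧ (n : ℝ) ≤ X ∧
          110 * Real.log (Real.log X) ^ 2 ≤
            ((n.totient.primeFactorsList).length : ℝ)} : ℝ) ≤
        1536 * X / Real.log X ^ 3 := by
  classical
  obtain ⟨X₀, h⟩ := lp_C
  have hev : ∀ᶠ X : ℝ in Filter.atTop, 1 ≤ Real.log (Real.log X) :=
    (Real.tendsto_log_atTop.comp Real.tendsto_log_atTop).eventually_ge_atTop 1
  obtain ⟨X₁, h₁⟩ := Filter.eventually_atTop.mp hev
  refine ⟨max X₀ (max X₁ 3), fun X hX => ?_⟩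
  have hX0 := (le_max_left _ _).trans hX
  have hX1 := ((le_max_left X₁ 3).trans (le_max_right _ _)).trans hX
  have hX3 := ((le_max_right X₁ 3).trans (le_max_right _ _)).trans hX
  have hC := h X hX0
  have hL := h₁ X hX1
  have hXp : 0 ≤ X := by linarith
  set L := Real.log (Real.log X) with hLdef
  have hsub : {n : ℕ | 0 < n ∧ (n : ℝ) ≤ X ∧
          110 * L ^ 2 ≤ ((n.totient.primeFactorsList).length : ℝ)} ⊆
      ((lpS X ∪ (lpS X).biUnion
        (fun m => (Finset.Ioc 0 ⌊X⌋₊).filter (fun n => (m + 1) ∣ n)) : Finset ℕ) : Set ℕ) := by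
    rintro n ⟨hn0, hnX, hn⟩
    have hnf : n ≤ ⌊X⌋₊ := Nat.le_floor hnX
    rw [Finset.mem_coe, Finset.mem_union]
    by_contra hcon
    push Not at hcon
    obtain ⟨c1, c2⟩ := hcon
    have k1 : (cardFactors n : ℝ) < 10 * L := by
      by_contra hc
      exact c1 (Finset.mem_filter.mpr ⟨Finset.mem_Icc.mpr ⟨hn0, hnf⟩, not_lt.mp hc⟩)
    have k2 : ∀ p : ℕ, p.Prime → p ∣ n → (cardFactors (p - 1) : ℝ) ≤ 10 * L := by
      intro p hp hpn
      by_contra hc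
      apply c2
      have hp2 := hp.two_le
      have hple := Nat.le_of_dvd hn0 hpn
      rw [Finset.mem_biUnion]
      refine ⟨p - 1, Finset.mem_filter.mpr ⟨Finset.mem_Icc.mpr ⟨by omega, by omega⟩,
        (not_le.mp hc).le⟩, Finset.mem_filter.mpr ⟨Finset.mem_Ioc.mpr ⟨hn0, hnf⟩, ?_⟩⟩
      rwa [Nat.sub_add_cancel hp.one_le]
    have k3 := lp_totient (10 * L) (by linarith) n hn0.ne' k2
    rw [← cardFactors_apply] at hn
    nlinarith
  have hcard := Set.ncard_le_ncard hsub (Finset.finite_toSet _)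
  rw [Set.ncard_coe_finset] at hcard
  have hcard2 := (hcard.trans (Finset.card_union_le _ _)).trans
    (Nat.add_le_add_left Finset.card_biUnion_le _)
  rw [← Nat.card_coe_set_eq] at hcard2
  have hc3 : (Nat.card {n : ℕ | 0 < n ∧ (n : ℝ) ≤ X ∧
          110 * L ^ 2 ≤ ((n.totient.primeFactorsList).length : ℝ)} : ℝ) ≤
      (lpS X).card + ∑ m ∈ lpS X,
        (((Finset.Ioc 0 ⌊X⌋₊).filter (fun n => (m + 1) ∣ n)).card : ℝ) := by
    exact_mod_cast hcard2
  have b1 : ((lpS X).card : ℝ) ≤ X * ∑ n ∈ lpS X, (1:ℝ) / n := by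
    rw [Finset.mul_sum, Finset.card_eq_sum_ones]
    push_cast
    apply Finset.sum_le_sum
    intro n hn
    have hn1 := Finset.mem_Icc.mp (Finset.mem_filter.mp hn).1
    have hnp : (0:ℝ) < n := by exact_mod_cast hn1.1
    rw [mul_one_div, le_div_iff₀ hnp, one_mul]
    exact (Nat.le_floor_iff hXp).mp hn1.2
  have b2 : ∑ m ∈ lpS X,
        (((Finset.Ioc 0 ⌊X⌋₊).filter (fun n => (m + 1) ∣ n)).card : ℝ)
        ≤ X * ∑ n ∈ lpS X, (1:ℝ) / n := by
    rw [Finset.mul_sum]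
    apply Finset.sum_le_sum
    intro m hm
    have hm1 := Finset.mem_Icc.mp (Finset.mem_filter.mp hm).1
    have hmp : (0:ℝ) < m := by exact_mod_cast hm1.1
    rw [Nat.Ioc_filter_dvd_card_eq_div, mul_one_div]
    calc ((⌊X⌋₊ / (m + 1) : ℕ) : ℝ) ≤ (⌊X⌋₊ : ℝ) / ((m + 1 : ℕ) : ℝ) := Nat.cast_div_le
      _ ≤ X / m := by
        have := Nat.floor_le hXp
        push_cast
        gcongr
        linarith
  calc _ ≤ _ := hc3
    _ ≤ 2 * (X * ∑ n ∈ lpS X, (1:ℝ) / n) := by linarith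
    _ ≤ 2 * (X * (768 / Real.log X ^ 3)) := by gcongr
    _ = _ := by ring

theorem stmt9 :
    ∃ C : ℝ, ∀ X : ℝ, 3 ≤ X →
      (Nat.card {n : ℕ | 0 < n ∧ (n : ℝ) ≤ X ∧
          110 * Real.log (Real.log X) ^ 2 ≤
            ((n.totient.primeFactorsList).length : ℝ)} : ℝ) ≤
        C * X / Real.log X ^ 3 := by
  obtain ⟨X₀, h⟩ := lp_main
  refine ⟨max 1536 (Real.log X₀ ^ 3), fun X hX => ?_⟩
  have hl : 0 < Real.log X := Real.log_pos (by linarith)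
  rcases le_total X₀ X with hc | hc
  · refine (h X hc).trans ?_
    gcongr
    exact le_max_left _ _
  · have hsub : {n : ℕ | 0 < n ∧ (n : ℝ) ≤ X ∧
          110 * Real.log (Real.log X) ^ 2 ≤ ((n.totient.primeFactorsList).length : ℝ)} ⊆
        ((Finset.Ioc 0 ⌊X⌋₊ : Finset ℕ) : Set ℕ) := by
      rintro n ⟨hn0, hnX, -⟩
      rw [Finset.mem_coe, Finset.mem_Ioc]
      exact ⟨hn0, Nat.le_floor hnX⟩
    have hcard := Set.ncard_le_ncard hsub (Finset.finite_toSet _)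
    rw [Set.ncard_coe_finset, Nat.card_Ioc, Nat.sub_zero, ← Nat.card_coe_set_eq] at hcard
    have h1 : (Nat.card {n : ℕ | 0 < n ∧ (n : ℝ) ≤ X ∧
          110 * Real.log (Real.log X) ^ 2 ≤
            ((n.totient.primeFactorsList).length : ℝ)} : ℝ) ≤ X :=
      (Nat.cast_le.mpr hcard).trans (Nat.floor_le (by linarith))
    refine h1.trans ?_
    rw [le_div_iff₀ (by positivity), mul_comm]
    have h2 : Real.log X ^ 3 ≤ max 1536 (Real.log X₀ ^ 3) := by
      refine le_trans ?_ (le_max_right _ _)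
      gcongr
    gcongr
end

section
/- There is an absolute constant C such that for all real numbers X and Z with X ≥ Z ≥ 2, the number of Z-dense positive integers n ≤ X is at most C·X·log Z/log X. -/
/-- A positive integer `n` is `Z`-dense if each ratio of consecutive divisors of `n`
is at most `Z`; equivalently, every divisor `d < n` is followed by another divisor
`e` with `d < e ≤ Z·d`. -/
def ZDense (Z : ℝ) (n : ℕ) : Prop :=
  ∀ d ∈ n.divisors, d < n → ∃ e ∈ n.divisors, d < e ∧ (e : ℝ) ≤ Z * d

/-- the completely multiplicative function `n ↦ n^(-s)` -/
noncomputable def hpow (s : ℝ) : ℕ →* ℝ where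
  toFun n := (n : ℝ) ^ (-s)
  map_one' := by simp
  map_mul' a b := by
    push_cast
    exact Real.mul_rpow (Nat.cast_nonneg a) (Nat.cast_nonneg b)

lemma hpow_apply (s : ℝ) (n : ℕ) : hpow s n = (n : ℝ) ^ (-s) := rfl

lemma hpow_nonneg (s : ℝ) (n : ℕ) : 0 ≤ hpow s n := Real.rpow_nonneg (Nat.cast_nonneg n) _

lemma hpow_pos (s : ℝ) {n : ℕ} (hn : n ≠ 0) : 0 < hpow s n :=
  Real.rpow_pos_of_pos (by positivity) _

lemma hpow_lt_one {s : ℝ} (hs : 0 < s) {p : ℕ} (hp : p.Prime) : hpow s p < 1 :=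
  Real.rpow_lt_one_of_one_lt_of_neg (by exact_mod_cast hp.one_lt) (by linarith)

lemma hpow_hasSum {s : ℝ} (hs : 0 < s) (S : Finset ℕ) :
    HasSum (fun m : Nat.factoredNumbers S ↦ hpow s m) (∏ p ∈ S with p.Prime, (1 - hpow s p)⁻¹) :=
  (EulerProduct.summable_and_hasSum_factoredNumbers_prod_filter_prime_geometric
    (f := hpow s) (fun {p} hp => by
      rw [Real.norm_of_nonneg (hpow_nonneg s p)]; exact hpow_lt_one hs hp) S).2

lemma sum_le_prod {s : ℝ} (hs : 0 < s) (S F : Finset ℕ) (hF : ∀ n ∈ F, n ∈ Nat.factoredNumbers S) :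
    ∑ n ∈ F, hpow s n ≤ ∏ p ∈ S with p.Prime, (1 - hpow s p)⁻¹ := by
  have h := hpow_hasSum hs S
  have := sum_le_hasSum (F.subtype (· ∈ Nat.factoredNumbers S))
    (fun i _ => hpow_nonneg s i) h
  refine le_trans (le_of_eq ?_) this
  rw [Finset.sum_subtype_eq_sum_filter, Finset.filter_true_of_mem hF]

lemma tele1 {σ : ℝ} (hσ : 0 < σ) {n : ℕ} (hn : 1 ≤ n) :
    (n : ℝ) ^ (-σ) - ((n + 1 : ℕ) : ℝ) ^ (-σ) ≤ σ * (n : ℝ) ^ (-(1 + σ)) := by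
  have hn0 : (0 : ℝ) < n := by exact_mod_cast hn
  have hn1 : (0 : ℝ) < ((n + 1 : ℕ) : ℝ) := by positivity
  have h1 : Real.log ((n + 1 : ℕ) : ℝ) - Real.log n ≤ 1 / n := by
    rw [← Real.log_div hn1.ne' hn0.ne']
    have := Real.log_le_sub_one_of_pos (div_pos hn1 hn0)
    refine this.trans (le_of_eq ?_)
    push_cast; field_simp; ring
  have h2 : ((n + 1 : ℕ) : ℝ) ^ (-σ) = (n : ℝ) ^ (-σ) *
      Real.exp (-σ * (Real.log ((n + 1 : ℕ) : ℝ) - Real.log n)) := by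
    rw [Real.rpow_def_of_pos hn1, Real.rpow_def_of_pos hn0, ← Real.exp_add]; congr 1; ring
  have h3 := Real.add_one_le_exp (-σ * (Real.log ((n + 1 : ℕ) : ℝ) - Real.log n))
  have h4 : (n : ℝ) ^ (-(1 + σ)) = (n : ℝ) ^ (-σ) * (1 / n) := by
    rw [show -(1 + σ) = -σ + -1 by ring, Real.rpow_add hn0, Real.rpow_neg_one]; simp
  have h5 : 0 < (n : ℝ) ^ (-σ) := Real.rpow_pos_of_pos hn0 _
  rw [h2, h4]
  have h6 : 1 - Real.exp (-σ * (Real.log ((n + 1 : ℕ) : ℝ) - Real.log n)) ≤ σ * (1 / n) := by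
    nlinarith [mul_le_mul_of_nonneg_left h1 hσ.le]
  nlinarith [mul_le_mul_of_nonneg_left h6 h5.le]

lemma tele2 {σ : ℝ} (hσ : 0 < σ) {n : ℕ} (hn : 1 ≤ n) :
    σ * ((n + 1 : ℕ) : ℝ) ^ (-(1 + σ)) ≤ (n : ℝ) ^ (-σ) - ((n + 1 : ℕ) : ℝ) ^ (-σ) := by
  have hn0 : (0 : ℝ) < n := by exact_mod_cast hn
  have hn1 : (0 : ℝ) < ((n + 1 : ℕ) : ℝ) := by positivity
  have h1 : 1 / ((n + 1 : ℕ) : ℝ) ≤ Real.log ((n + 1 : ℕ) : ℝ) - Real.log n := by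
    have := Real.log_le_sub_one_of_pos (div_pos hn0 hn1)
    rw [Real.log_div hn0.ne' hn1.ne'] at this
    have h : (n : ℝ) / ((n + 1 : ℕ) : ℝ) - 1 = - (1 / ((n + 1 : ℕ) : ℝ)) := by
      push_cast; field_simp; ring
    linarith
  have h2 : (n : ℝ) ^ (-σ) = ((n + 1 : ℕ) : ℝ) ^ (-σ) *
      Real.exp (σ * (Real.log ((n + 1 : ℕ) : ℝ) - Real.log n)) := by
    rw [Real.rpow_def_of_pos hn1, Real.rpow_def_of_pos hn0, ← Real.exp_add]; congr 1; ring
  have h3 := Real.add_one_le_exp (σ * (Real.log ((n + 1 : ℕ) : ℝ) - Real.log n))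
  have h4 : ((n + 1 : ℕ) : ℝ) ^ (-(1 + σ)) = ((n + 1 : ℕ) : ℝ) ^ (-σ) * (1 / ((n + 1 : ℕ) : ℝ)) := by
    rw [show -(1 + σ) = -σ + -1 by ring, Real.rpow_add hn1, Real.rpow_neg_one]; simp
  have h5 : 0 < ((n + 1 : ℕ) : ℝ) ^ (-σ) := Real.rpow_pos_of_pos hn1 _
  rw [h2, h4]
  have h6 : σ * (1 / ((n + 1 : ℕ) : ℝ)) ≤
      Real.exp (σ * (Real.log ((n + 1 : ℕ) : ℝ) - Real.log n)) - 1 := by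
    nlinarith [mul_le_mul_of_nonneg_left h1 hσ.le]
  nlinarith [mul_le_mul_of_nonneg_left h6 h5.le]

lemma zsum_lower {σ : ℝ} (hσ : 0 < σ) (N : ℕ) (hN : 1 ≤ N) :
    1 - (N : ℝ) ^ (-σ) ≤ σ * ∑ n ∈ Finset.Ico 1 N, hpow (1 + σ) n := by
  induction N, hN using Nat.le_induction with
  | base => simp
  | succ n hn ih =>
    rw [Finset.sum_Ico_succ_top hn, mul_add, hpow_apply]
    linarith [tele1 hσ hn]

lemma zsum_upper {σ : ℝ} (hσ : 0 < σ) (N : ℕ) (hN : 1 ≤ N) :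
    σ * ∑ n ∈ Finset.Icc 1 N, hpow (1 + σ) n ≤ σ + 1 - (N : ℝ) ^ (-σ) := by
  induction N, hN using Nat.le_induction with
  | base => simp
  | succ n hn ih =>
    rw [Finset.sum_Icc_succ_top (by omega), mul_add, hpow_apply]
    linarith [tele2 hσ hn]

lemma zsum_upper' {σ : ℝ} (hσ : 0 < σ) (F : Finset ℕ) (hF : 0 ∉ F) :
    ∑ n ∈ F, hpow (1 + σ) n ≤ 1 + 1 / σ := by
  set N := F.sup id + 1
  have h1 : F ⊆ Finset.Icc 1 N := fun n hn => by
    have h2 : n ≤ F.sup id := Finset.le_sup (f := id) hn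
    have : n ≠ 0 := fun h => hF (h ▸ hn)
    simp only [Finset.mem_Icc]; omega
  have h2 := zsum_upper hσ N (by omega)
  have h3 : ∑ n ∈ F, hpow (1 + σ) n ≤ ∑ n ∈ Finset.Icc 1 N, hpow (1 + σ) n :=
    Finset.sum_le_sum_of_subset_of_nonneg h1 fun _ _ _ => hpow_nonneg _ _
  have h4 : 0 ≤ (N : ℝ) ^ (-σ) := Real.rpow_nonneg (Nat.cast_nonneg _) _
  have h5 : 1 + 1 / σ = (σ + 1) / σ := by field_simp
  rw [h5, le_div_iff₀ hσ]
  nlinarith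

lemma prod_upper {σ : ℝ} (hσ : 0 < σ) (S : Finset ℕ) :
    ∏ p ∈ S with p.Prime, (1 - hpow (1 + σ) p)⁻¹ ≤ 1 + 1 / σ := by
  refine hasSum_le_of_sum_le (hpow_hasSum (by linarith) S) fun F => ?_
  have := zsum_upper' hσ (F.map (Function.Embedding.subtype _)) (by
    simp only [Finset.mem_map, not_exists, not_and]
    rintro ⟨x, hx⟩ _ h
    exact Nat.ne_zero_of_mem_factoredNumbers hx h)
  simpa using this

lemma prod_lower {s : ℝ} (hs : 0 < s) (N : ℕ) :
    ∑ n ∈ Finset.Ico 1 N, hpow s n ≤ ∏ p ∈ N.primesBelow, (1 - hpow s p)⁻¹ := by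
  refine sum_le_prod hs (Finset.range N) _ fun n hn => ?_
  rw [← Nat.smoothNumbers_eq_factoredNumbers]
  simp only [Finset.mem_Ico] at hn
  exact Nat.mem_smoothNumbers_of_lt hn.1 hn.2

lemma prod_lower_one (N : ℕ) (hN : 1 ≤ N) :
    Real.log N ≤ ∏ p ∈ N.primesBelow, (1 - hpow 1 p)⁻¹ := by
  refine le_trans ?_ (prod_lower one_pos N)
  induction N, hN using Nat.le_induction with
  | base => simp
  | succ n hn ih =>
    rw [Finset.sum_Ico_succ_top hn, hpow_apply]
    have hn0 : (0 : ℝ) < n := by exact_mod_cast hn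
    have hn1 : (0 : ℝ) < ((n + 1 : ℕ) : ℝ) := by positivity
    have h1 : Real.log ((n + 1 : ℕ) : ℝ) - Real.log n ≤ (n : ℝ) ^ (-1 : ℝ) := by
      rw [← Real.log_div hn1.ne' hn0.ne', Real.rpow_neg_one]
      have := Real.log_le_sub_one_of_pos (div_pos hn1 hn0)
      refine this.trans (le_of_eq ?_)
      push_cast; field_simp; ring
    linarith

lemma sum_log_floor (N : ℕ) :
    ∑ p ∈ (N + 1).primesBelow, ((N / p : ℕ) : ℝ) * Real.log p ≤ N * Real.log N := by
  have h1 : ∀ n ∈ Finset.Ioc 0 N, ∑ p ∈ (N + 1).primesBelow with p ∣ n, Real.log p ≤ Real.log N := by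
    intro n hn
    simp only [Finset.mem_Ioc] at hn
    have h2 : ∑ p ∈ (N + 1).primesBelow with p ∣ n, Real.log p = ∑ p ∈ n.primeFactors, Real.log p := by
      apply Finset.sum_congr _ (fun _ _ => rfl)
      ext p
      simp only [Finset.mem_filter, Nat.mem_primesBelow, Nat.mem_primeFactors]
      constructor
      · rintro ⟨⟨a, b⟩, c⟩; exact ⟨b, c, by omega⟩
      · rintro ⟨a, b, c⟩
        have := Nat.le_of_dvd (by omega) b
        exact ⟨⟨by omega, a⟩, b⟩
    rw [h2, ← Real.log_prod (fun p hp => by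
      exact_mod_cast (Nat.prime_of_mem_primeFactors hp).ne_zero)]
    have h3 : ∏ p ∈ n.primeFactors, p ≤ N :=
      (Nat.le_of_dvd (by omega) (Nat.prod_primeFactors_dvd n)).trans hn.2
    have h4 : 0 < ∏ p ∈ n.primeFactors, p :=
      Finset.prod_pos fun p hp => (Nat.prime_of_mem_primeFactors hp).pos
    rw [← Nat.cast_prod]
    apply Real.log_le_log
    · exact_mod_cast h4
    · exact_mod_cast h3
  have h5 := Finset.sum_le_sum h1
  simp only [Finset.sum_const, Nat.card_Ioc, nsmul_eq_mul, Nat.sub_zero, Finset.sum_filter] at h5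
  rw [Finset.sum_comm] at h5
  refine le_trans (le_of_eq ?_) h5
  refine Finset.sum_congr rfl fun p _ => ?_
  rw [← Finset.sum_filter, Finset.sum_const, Nat.Ioc_filter_dvd_card_eq_div, nsmul_eq_mul]

lemma mertens_nat (N : ℕ) (hN : 1 ≤ N) :
    ∑ p ∈ (N + 1).primesBelow, Real.log p / p ≤ Real.log N + Real.log 4 := by
  have hN0 : (0 : ℝ) < N := by exact_mod_cast hN
  have h1 := sum_log_floor N
  have h2 : ∑ p ∈ (N + 1).primesBelow, Real.log p ≤ Real.log 4 * N := by
    have := Chebyshev.theta_le_log4_mul_x (x := N) hN0.le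
    rwa [Chebyshev.theta_eq_sum_primesLE_log] at this
  have h3 : N * ∑ p ∈ (N + 1).primesBelow, Real.log p / p ≤
      ∑ p ∈ (N + 1).primesBelow, ((N / p : ℕ) : ℝ) * Real.log p +
      ∑ p ∈ (N + 1).primesBelow, Real.log p := by
    rw [Finset.mul_sum, ← Finset.sum_add_distrib]
    refine Finset.sum_le_sum fun p hp => ?_
    have hp0 : (0 : ℝ) < p := by exact_mod_cast (Nat.prime_of_mem_primesBelow hp).pos
    have hl : 0 ≤ Real.log p := Real.log_natCast_nonneg p
    have := (Nat.lt_floor_add_one ((N : ℝ) / p)).le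
    rw [Nat.floor_div_natCast, Nat.floor_natCast] at this
    calc (N : ℝ) * (Real.log p / p) = (N / p) * Real.log p := by ring
      _ ≤ (((N / p : ℕ) : ℝ) + 1) * Real.log p := by gcongr
      _ = _ := by ring
  have h4 : N * ∑ p ∈ (N + 1).primesBelow, Real.log p / p ≤ N * (Real.log N + Real.log 4) := by
    linarith
  exact le_of_mul_le_mul_left h4 hN0

lemma mertens_nat' (N : ℕ) (hN : 1 ≤ N) :
    ∑ p ∈ (N + 1).primesBelow, Real.log p / (p - 1) ≤ Real.log N + 14 := by
  have h1 := mertens_nat N hN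
  have h2 := zsum_upper' (σ := 1 / 2) (by norm_num) (N + 1).primesBelow
    (fun h => by simpa using (Nat.prime_of_mem_primesBelow h).ne_zero)
  have h4 : Real.log 4 ≤ 2 := by
    rw [show (4 : ℝ) = 2 ^ 2 by norm_num, Real.log_pow]
    have := Real.log_two_lt_d9
    push_cast; linarith
  have h3 : ∑ p ∈ (N + 1).primesBelow, Real.log p / (p - 1) ≤
      ∑ p ∈ (N + 1).primesBelow, Real.log p / p + 4 * ∑ p ∈ (N + 1).primesBelow, hpow (1 + 1 / 2) p := by
    rw [Finset.mul_sum, ← Finset.sum_add_distrib]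
    refine Finset.sum_le_sum fun p hp => ?_
    have hp2 : (2 : ℝ) ≤ p := by exact_mod_cast (Nat.prime_of_mem_primesBelow hp).two_le
    have hp0 : (0 : ℝ) < p := by linarith
    have hl : Real.log p ≤ 2 * (p : ℝ) ^ (1 / 2 : ℝ) := by
      have := Real.log_le_rpow_div hp0.le (ε := 1 / 2) (by norm_num)
      linarith
    have e1 : Real.log p / (p - 1) = Real.log p / p + Real.log p / (p * (p - 1)) := by
      have : (p : ℝ) - 1 ≠ 0 := by linarith
      field_simp; ring
    have e2 : hpow (1 + 1 / 2) p = (p : ℝ) ^ (1 / 2 : ℝ) / p ^ 2 := by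
      rw [hpow_apply, ← Real.rpow_natCast, ← Real.rpow_sub hp0]; norm_num
    rw [e1, e2]
    have hr : 0 ≤ (p : ℝ) ^ (1 / 2 : ℝ) := Real.rpow_nonneg hp0.le _
    have : Real.log p / (p * (p - 1)) ≤ 2 * (p : ℝ) ^ (1 / 2 : ℝ) / (p ^ 2 / 2) := by
      apply div_le_div₀ (by positivity) hl (by positivity); nlinarith
    refine add_le_add le_rfl (this.trans (le_of_eq ?_))
    field_simp; norm_num
  linarith

lemma mertens (N : ℕ) (w : ℝ) (hw : 1 ≤ w) :
    ∑ p ∈ N.primesBelow.filter (fun p : ℕ => (p : ℝ) ≤ w), Real.log p / (p - 1) ≤ Real.log w + 14 := by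
  have hf : 1 ≤ ⌊w⌋₊ := Nat.one_le_floor_iff _ |>.2 hw
  refine le_trans ?_ ((mertens_nat' ⌊w⌋₊ hf).trans ?_)
  · apply Finset.sum_le_sum_of_subset_of_nonneg
    · intro p
      simp only [Finset.mem_filter, Nat.mem_primesBelow]
      rintro ⟨⟨_, h2⟩, h3⟩
      exact ⟨Nat.lt_succ_of_le (Nat.le_floor h3), h2⟩
    · intro p hp _
      have hp2 : (2 : ℝ) ≤ p := by exact_mod_cast (Nat.prime_of_mem_primesBelow hp).two_le
      exact div_nonneg (Real.log_natCast_nonneg p) (by linarith)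
  · have := Real.log_le_log (by exact_mod_cast hf) (Nat.floor_le (by linarith : 0 ≤ w))
    linarith

/-- one Euler factor ratio -/
lemma factor_ratio {a b : ℝ} (h1 : b < 1) :
    (1 - b)⁻¹ ≤ (1 - a)⁻¹ * Real.exp ((b - a) / (1 - b)) ∨ 1 ≤ a := by
  by_cases ha : 1 ≤ a
  · exact Or.inr ha
  left
  have hb : 0 < 1 - b := by linarith
  have ha' : 0 < 1 - a := by linarith
  have := Real.add_one_le_exp ((b - a) / (1 - b))
  have e : (b - a) / (1 - b) + 1 = (1 - a) / (1 - b) := by field_simp; ring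
  rw [e] at this
  calc (1 - b)⁻¹ = (1 - a)⁻¹ * ((1 - a) / (1 - b)) := by field_simp
    _ ≤ _ := by gcongr

lemma factor_ratio' {a b : ℝ} (h1 : b < 1) (ha : a < 1) :
    (1 - b)⁻¹ ≤ (1 - a)⁻¹ * Real.exp ((b - a) / (1 - b)) :=
  (factor_ratio h1).resolve_right (by linarith)

lemma log8 : 2 < Real.log 8 := by
  rw [show (8 : ℝ) = 2 ^ 3 by norm_num, Real.log_pow]
  have := Real.log_two_gt_d9
  push_cast; linarith

lemma rankin_factor {δ : ℝ} (hδ : 0 < δ) (hδ2 : δ ≤ 1 / 2) {p : ℕ} (hp : p.Prime)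
    (hpl : δ * Real.log p ≤ 1) :
    (1 - hpow (1 - δ) p)⁻¹ ≤ (1 - hpow (1 + δ) p)⁻¹ * Real.exp (24 * δ * (Real.log p / (p - 1))) := by
  have hp2 : (2 : ℝ) ≤ p := by exact_mod_cast hp.two_le
  have hp0 : (0 : ℝ) < p := by linarith
  have hl : 0 < Real.log p := Real.log_pos (by linarith)
  refine (factor_ratio' (hpow_lt_one (by linarith) hp) (hpow_lt_one (s := 1 + δ) (by linarith) hp)).trans ?_
  have hpos : 0 < 1 - hpow (1 + δ) p := by linarith [hpow_lt_one (s := 1 + δ) (by linarith) hp]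
  gcongr
  have e1 : hpow (1 - δ) p = Real.exp (δ * Real.log p) / p := by
    rw [hpow_apply, show -(1 - δ) = δ - 1 by ring, Real.rpow_sub hp0, Real.rpow_one,
      Real.rpow_def_of_pos hp0, mul_comm]
  have e2 : hpow (1 + δ) p = Real.exp (-(δ * Real.log p)) / p := by
    rw [hpow_apply, show -(1 + δ) = -δ - 1 by ring, Real.rpow_sub hp0, Real.rpow_one,
      Real.rpow_def_of_pos hp0]; congr 2; ring
  have e3 : hpow (1 - δ) p ≤ 3 / 4 := by
    rw [hpow_apply]
    calc (p : ℝ) ^ (-(1 - δ)) ≤ (p : ℝ) ^ (-(1 / 2 : ℝ)) :=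
          Real.rpow_le_rpow_of_exponent_le (by linarith) (by linarith)
      _ ≤ (2 : ℝ) ^ (-(1 / 2 : ℝ)) :=
          Real.rpow_le_rpow_of_nonpos (by norm_num) hp2 (by norm_num)
      _ ≤ 3 / 4 := by
          rw [Real.rpow_neg (by norm_num), ← Real.sqrt_eq_rpow]
          have : (4 / 3 : ℝ) ≤ Real.sqrt 2 := Real.le_sqrt_of_sq_le (by norm_num)
          rw [inv_le_comm₀ (by positivity) (by norm_num)]
          linarith
  have e4 : hpow (1 - δ) p - hpow (1 + δ) p ≤ 6 * δ * Real.log p / p := by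
    rw [e1, e2, ← sub_div]
    gcongr
    set t := δ * Real.log p with ht
    have ht0 : 0 < t := by positivity
    have h3 : Real.exp t ≤ 3 := by
      have := Real.exp_one_lt_d9
      have := Real.exp_le_exp.2 hpl
      linarith
    have h4 : Real.exp (-t) = Real.exp t * Real.exp (-(2 * t)) := by
      rw [← Real.exp_add]; congr 1; ring
    have h5 := Real.add_one_le_exp (-(2 * t))
    rw [h4]
    have h6 := Real.exp_pos t
    nlinarith
  have hx : hpow (1 + δ) p ≤ hpow (1 - δ) p :=
    Real.rpow_le_rpow_of_exponent_le (by linarith) (by linarith)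
  calc (hpow (1 - δ) p - hpow (1 + δ) p) / (1 - hpow (1 - δ) p)
      ≤ (6 * δ * Real.log p / p) / (1 / 4) := by
        apply div_le_div₀ (by positivity) e4 (by norm_num) (by linarith)
    _ = 24 * δ * (Real.log p / p) := by ring
    _ ≤ _ := by gcongr <;> linarith

lemma rankin_prod {y : ℝ} (hy : 8 ≤ y) :
    ∏ p ∈ (⌊y⌋₊ + 1).primesBelow, (1 - hpow (1 - 1 / Real.log y) p)⁻¹ ≤
      2 * Real.exp 200 * Real.log y := by
  have hl : 2 < Real.log y := log8.trans_le (Real.log_le_log (by norm_num) hy)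
  set δ := 1 / Real.log y with hδd
  have hδ : 0 < δ := by positivity
  have hδ2 : δ ≤ 1 / 2 := by
    rw [hδd]; exact one_div_le_one_div_of_le (by norm_num) hl.le
  have hmem : ∀ p ∈ (⌊y⌋₊ + 1).primesBelow, p.Prime ∧ (p : ℝ) ≤ y := by
    intro p hp
    rw [Nat.mem_primesBelow] at hp
    exact ⟨hp.2, (Nat.le_floor_iff (by linarith)).1 (Nat.lt_succ_iff.1 hp.1)⟩
  have h1 : ∏ p ∈ (⌊y⌋₊ + 1).primesBelow, (1 - hpow (1 - δ) p)⁻¹ ≤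
      ∏ p ∈ (⌊y⌋₊ + 1).primesBelow, ((1 - hpow (1 + δ) p)⁻¹ *
        Real.exp (24 * δ * (Real.log p / (p - 1)))) := by
    refine Finset.prod_le_prod (fun p hp => ?_) fun p hp => ?_
    · have := hpow_lt_one (s := 1 - δ) (by linarith) (hmem p hp).1
      exact inv_nonneg.2 (by linarith)
    · refine rankin_factor hδ hδ2 (hmem p hp).1 ?_
      have hp0 : (0 : ℝ) < p := by exact_mod_cast (hmem p hp).1.pos
      have := Real.log_le_log hp0 (hmem p hp).2
      rw [hδd, one_div, inv_mul_le_iff₀ (by linarith)]; linarith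
  refine h1.trans ?_
  rw [Finset.prod_mul_distrib, ← Real.exp_sum, ← Finset.mul_sum]
  have h2 := prod_upper hδ (Finset.range (⌊y⌋₊ + 1))
  have h3 := mertens (⌊y⌋₊ + 1) y (by linarith)
  rw [Finset.filter_true_of_mem (fun p hp => (hmem p hp).2)] at h3
  have h4 : 24 * δ * ∑ p ∈ (⌊y⌋₊ + 1).primesBelow, Real.log p / (p - 1) ≤ 200 := by
    calc _ ≤ 24 * δ * (Real.log y + 14) := by gcongr
      _ = 24 * (δ * Real.log y) + 336 * δ := by ring
      _ = 24 * 1 + 336 * δ := by rw [hδd, one_div, inv_mul_cancel₀ (by linarith)]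
      _ ≤ 200 := by linarith
  have h5 : 1 + 1 / δ ≤ 2 * Real.log y := by rw [hδd, one_div_one_div]; linarith
  have h6 : 0 ≤ ∏ p ∈ (⌊y⌋₊ + 1).primesBelow, (1 - hpow (1 + δ) p)⁻¹ :=
    Finset.prod_nonneg fun p hp => by
      have := hpow_lt_one (s := 1 + δ) (by linarith) (hmem p hp).1
      exact inv_nonneg.2 (by linarith)
  calc _ ≤ (2 * Real.log y) * Real.exp 200 := by
        apply mul_le_mul (h2.trans h5) (Real.exp_le_exp.2 h4) (Real.exp_pos _).le (by linarith)
    _ = _ := by ring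

/-- reciprocal sums over integers with all prime factors in `[q, y]`, Rankin weighted -/
lemma rough_sum {y q δ : ℝ} (hy : 8 ≤ y) (hq : q ≤ y) (hδ0 : 0 ≤ δ) (hδ : δ ≤ 1 / Real.log y)
    (F : Finset ℕ) (hF : ∀ t ∈ F, t ≠ 0 ∧ ∀ p, p.Prime → p ∣ t → q ≤ p ∧ (p : ℝ) ≤ y) :
    ∑ t ∈ F, hpow (1 - δ) t ≤ 8 * Real.exp 200 * Real.log y / Real.log (max 8 q) := by
  have hl : 2 < Real.log y := log8.trans_le (Real.log_le_log (by norm_num) hy)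
  set δ' := 1 / Real.log y with hδd
  have hδ2 : δ' ≤ 1 / 2 := by
    rw [hδd]; exact one_div_le_one_div_of_le (by norm_num) hl.le
  have h0 : ∀ p, p.Prime → hpow (1 - δ) p ≤ hpow (1 - δ') p := fun p hp =>
    Real.rpow_le_rpow_of_exponent_le (by exact_mod_cast hp.one_lt.le) (by linarith)
  have hlt : ∀ p, p.Prime → hpow (1 - δ') p < 1 := fun p hp => hpow_lt_one (by linarith) hp
  have hlt1 : ∀ p, p.Prime → hpow 1 p < 1 := fun p hp => hpow_lt_one (by linarith) hp
  have h01 : ∀ p, p.Prime → hpow 1 p ≤ hpow (1 - δ) p := fun p hp =>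
    Real.rpow_le_rpow_of_exponent_le (by exact_mod_cast hp.one_lt.le) (by linarith)
  set A := (⌊y⌋₊ + 1).primesBelow
  have hA : ∀ p ∈ A, p.Prime := fun p hp => (Nat.mem_primesBelow.1 hp).2
  set S := A.filter (fun p : ℕ => ¬ (p : ℝ) < q) with hS
  have hSp : S.filter Nat.Prime = S := Finset.filter_true_of_mem fun p hp =>
    hA p (Finset.mem_filter.1 hp).1
  have h1 := sum_le_prod (s := 1 - δ) (by linarith) S F (fun t ht => by
    rw [Nat.mem_factoredNumbers']
    intro p hp hpt
    obtain ⟨h2, h3⟩ := (hF t ht).2 p hp hpt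
    rw [hS, Finset.mem_filter, Nat.mem_primesBelow]
    exact ⟨⟨Nat.lt_succ_iff.2 (Nat.le_floor h3), hp⟩, not_lt.2 h2⟩)
  rw [hSp] at h1
  have hinv : ∀ p ∈ A, 0 < (1 - hpow (1 - δ) p)⁻¹ := fun p hp =>
    inv_pos.2 (by linarith [h0 p (hA p hp), hlt p (hA p hp)])
  have hall : ∏ p ∈ A, (1 - hpow (1 - δ) p)⁻¹ ≤ 2 * Real.exp 200 * Real.log y := by
    refine le_trans (Finset.prod_le_prod (fun p hp => (hinv p hp).le) fun p hp => ?_) (rankin_prod hy)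
    have := h0 p (hA p hp)
    have := hlt p (hA p hp)
    exact inv_anti₀ (by linarith) (by linarith)
  have hsplit : (∏ p ∈ A.filter (fun p : ℕ => (p : ℝ) < q), (1 - hpow (1 - δ) p)⁻¹) *
      ∏ p ∈ S, (1 - hpow (1 - δ) p)⁻¹ = ∏ p ∈ A, (1 - hpow (1 - δ) p)⁻¹ :=
    Finset.prod_filter_mul_prod_filter_not _ _ _
  have hE : 0 < Real.exp 200 := Real.exp_pos _
  have hlow : 1 ≤ ∏ p ∈ A.filter (fun p : ℕ => (p : ℝ) < q), (1 - hpow (1 - δ) p)⁻¹ := by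
    refine le_trans (Finset.prod_const_one (s := A.filter (fun p : ℕ => (p : ℝ) < q))).symm.le ?_
    refine Finset.prod_le_prod (fun _ _ => zero_le_one) fun p hp => ?_
    have hp' := (Finset.mem_filter.1 hp).1
    have := h0 p (hA p hp')
    have := hlt p (hA p hp')
    exact (one_le_inv₀ (by linarith)).2 (by linarith [hpow_nonneg (1 - δ) p])
  have hSn : 0 < ∏ p ∈ S, (1 - hpow (1 - δ) p)⁻¹ :=
    Finset.prod_pos fun p hp => hinv p (Finset.mem_filter.1 hp).1
  refine h1.trans ?_
  have hm : 2 < Real.log (max 8 q) := log8.trans_le (Real.log_le_log (by norm_num) (le_max_left _ _))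
  rw [le_div_iff₀ (by linarith)]
  by_cases hq8 : q ≤ 8
  · rw [max_eq_left hq8]
    have h8 : Real.log 8 < 4 := by
      rw [show (8 : ℝ) = 2 ^ 3 by norm_num, Real.log_pow]
      have := Real.log_two_lt_d9
      push_cast; linarith
    nlinarith
  · push Not at hq8
    rw [max_eq_right hq8.le]
    have h2 : Real.log q ≤ ∏ p ∈ A.filter (fun p : ℕ => (p : ℝ) < q), (1 - hpow (1 - δ) p)⁻¹ := by
      have hc : 1 ≤ ⌈q⌉₊ := Nat.one_le_ceil_iff.2 (by linarith)
      calc Real.log q ≤ Real.log ⌈q⌉₊ := Real.log_le_log (by linarith) (Nat.le_ceil q)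
        _ ≤ _ := prod_lower_one _ hc
        _ ≤ ∏ p ∈ ⌈q⌉₊.primesBelow, (1 - hpow (1 - δ) p)⁻¹ := by
            refine Finset.prod_le_prod (fun p hp => ?_) fun p hp => ?_
            · have hp' := (Nat.mem_primesBelow.1 hp).2
              exact inv_nonneg.2 (by linarith [hlt1 p hp'])
            · have hp' := (Nat.mem_primesBelow.1 hp).2
              exact inv_anti₀ (by linarith [h0 p hp', hlt p hp']) (by linarith [h01 p hp'])
        _ = _ := by
            apply Finset.prod_congr _ fun _ _ => rfl
            ext p
            simp only [A, Finset.mem_filter, Nat.mem_primesBelow, Nat.lt_ceil]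
            constructor
            · rintro ⟨a, b⟩
              exact ⟨⟨Nat.lt_succ_iff.2 (Nat.le_floor (a.le.trans hq)), b⟩, a⟩
            · rintro ⟨⟨a, b⟩, c⟩; exact ⟨c, b⟩
    calc _ ≤ (∏ p ∈ S, (1 - hpow (1 - δ) p)⁻¹) *
          ∏ p ∈ A.filter (fun p : ℕ => (p : ℝ) < q), (1 - hpow (1 - δ) p)⁻¹ := by gcongr
      _ = ∏ p ∈ A, (1 - hpow (1 - δ) p)⁻¹ := by rw [mul_comm, hsplit]
      _ ≤ _ := hall
      _ ≤ _ := by nlinarith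

/-- density in terms of prime factors -/
def PD (Z : ℝ) (n : ℕ) : Prop :=
  n ≠ 0 ∧ ∀ p : ℕ, p.Prime → p ∣ n →
    ∃ d : ℕ, d ∣ n ∧ (∀ q : ℕ, q.Prime → q ∣ d → q < p) ∧ (p : ℝ) ≤ Z * d

lemma ZDense.pd {Z : ℝ} {n : ℕ} (hn : 0 < n) (h : ZDense Z n) : PD Z n := by
  classical
  refine ⟨hn.ne', fun p hp hpn => ?_⟩
  set A := n.divisors.filter (fun d => ∀ q : ℕ, q.Prime → q ∣ d → q < p) with hA
  have hne : A.Nonempty := ⟨1, by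
    simp only [hA, Finset.mem_filter, Nat.mem_divisors]
    exact ⟨⟨one_dvd _, hn.ne'⟩, fun q hq h1 => absurd (Nat.dvd_one.1 h1) hq.ne_one⟩⟩
  obtain ⟨d, hdA, hmax⟩ := A.exists_max_image id hne
  have hd := hdA
  simp only [hA, Finset.mem_filter, Nat.mem_divisors] at hd
  have hdn : d < n := by
    refine lt_of_le_of_ne (Nat.le_of_dvd hn hd.1.1) fun h1 => ?_
    exact lt_irrefl _ (hd.2 p hp (h1 ▸ hpn))
  obtain ⟨e, he, hde, hez⟩ := h d (Nat.mem_divisors.2 hd.1) hdn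
  have heA : e ∉ A := fun h1 => absurd (hmax e h1) (by simpa using hde)
  simp only [hA, Finset.mem_filter, not_and] at heA
  have h2 := heA he
  push Not at h2
  obtain ⟨q, hq, hqe, hpq⟩ := h2
  have hqle : q ≤ e := Nat.le_of_dvd (by omega) hqe
  refine ⟨d, hd.1.1, hd.2, le_trans ?_ hez⟩
  exact_mod_cast hpq.trans hqle

lemma coprime_of_lt {d r p : ℕ} (h1 : ∀ q : ℕ, q.Prime → q ∣ d → q < p)
    (h2 : ∀ q : ℕ, q.Prime → q ∣ r → p ≤ q) : Nat.Coprime d r :=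
  Nat.coprime_of_dvd fun q hq hqd hqr => absurd (h1 q hq hqd) (not_lt.2 (h2 q hq hqr))

lemma PD.split {Z : ℝ} {n : ℕ} (h : PD Z n) {Y : ℝ} (hY : 1 ≤ Y) (hYn : Y < n) (hZ : 0 ≤ Z) :
    ∃ m r : ℕ, m * r = n ∧ PD Z m ∧ (m : ℝ) ≤ Y ∧ Y ≤ Z * m ^ 2 ∧
      ∀ p : ℕ, p.Prime → p ∣ r → Y / m ≤ p ∧ ∀ q : ℕ, q.Prime → q ∣ m → q ≤ p := by
  classical
  set A := n.divisors.filter (fun m : ℕ => (m : ℝ) ≤ Y ∧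
    ∀ p : ℕ, p.Prime → p ∣ n / m → ∀ q : ℕ, q.Prime → q ∣ m → q ≤ p) with hA
  have hne : A.Nonempty := ⟨1, by
    simp only [hA, Finset.mem_filter, Nat.mem_divisors]
    exact ⟨⟨one_dvd _, h.1⟩, by simpa using hY, fun p _ _ q hq h1 =>
      absurd (Nat.dvd_one.1 h1) hq.ne_one⟩⟩
  obtain ⟨m, hmA, hmax⟩ := A.exists_max_image id hne
  simp only [hA, Finset.mem_filter, Nat.mem_divisors] at hmA
  obtain ⟨⟨⟨r, hr⟩, _⟩, hmY, hpq⟩ := hmA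
  have hm0 : 0 < m := Nat.pos_of_ne_zero fun h1 => h.1 (by simp [hr, h1])
  have hr0 : 0 < r := Nat.pos_of_ne_zero fun h1 => h.1 (by simp [hr, h1])
  have hdiv : n / m = r := by rw [hr]; exact Nat.mul_div_cancel_left r hm0
  rw [hdiv] at hpq
  have hr1 : r ≠ 1 := by
    rintro rfl
    rw [hr, mul_one] at hYn
    linarith
  set q := r.minFac with hq
  have hqp : q.Prime := Nat.minFac_prime hr1
  obtain ⟨t, ht⟩ : q ∣ r := Nat.minFac_dvd r
  have hbig : Y < m * q := by
    by_contra hcon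
    push Not at hcon
    have hmem : m * q ∈ A := by
      simp only [hA, Finset.mem_filter, Nat.mem_divisors]
      have hd : n = m * q * t := by rw [hr, ht]; ring
      have hdiv2 : n / (m * q) = t := by
        rw [hd]; exact Nat.mul_div_cancel_left t (Nat.mul_pos hm0 hqp.pos)
      refine ⟨⟨⟨t, hd⟩, h.1⟩, by exact_mod_cast hcon, ?_⟩
      rw [hdiv2]
      intro p hp hpt q' hq' hq'd
      have hpr : p ∣ r := ht ▸ Dvd.dvd.mul_left hpt q
      rcases (Nat.Prime.dvd_mul hq').1 hq'd with h1 | h1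
      · exact hpq p hp hpr q' hq' h1
      · rw [(Nat.prime_dvd_prime_iff_eq hq' hqp).1 h1]
        exact Nat.minFac_le_of_dvd hp.two_le hpr
    have := hmax _ hmem
    simp only [id] at this
    have h2 := hqp.two_le
    nlinarith
  have hmin : ∀ p : ℕ, p.Prime → p ∣ r → q ≤ p := fun p hp hpr =>
    Nat.minFac_le_of_dvd hp.two_le hpr
  have hm0' : (0 : ℝ) < m := by exact_mod_cast hm0
  have hqZ : (q : ℝ) ≤ Z * m := by
    obtain ⟨d, hd, hdq, hqd⟩ := h.2 q hqp (hr ▸ Dvd.dvd.mul_left (Nat.minFac_dvd r) m)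
    have hc := coprime_of_lt hdq hmin
    rw [hr] at hd
    have hdm : d ∣ m := hc.dvd_of_dvd_mul_right hd
    have : (d : ℝ) ≤ m := by exact_mod_cast Nat.le_of_dvd hm0 hdm
    exact hqd.trans (by gcongr)
  refine ⟨m, r, hr.symm, ⟨hm0.ne', fun p hp hpm => ?_⟩, hmY, ?_, fun p hp hpr => ⟨?_, hpq p hp hpr⟩⟩
  · obtain ⟨d, hd, hdq, hqd⟩ := h.2 p hp (hr ▸ Dvd.dvd.mul_right hpm r)
    have hc : Nat.Coprime d r := coprime_of_lt hdq fun q' hq' hq'r => hpq q' hq' hq'r p hp hpm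
    rw [hr] at hd
    exact ⟨d, hc.dvd_of_dvd_mul_right hd, hdq, hqd⟩
  · nlinarith
  · rw [div_le_iff₀ hm0']
    have : (q : ℝ) ≤ p := by exact_mod_cast hmin p hp hpr
    nlinarith

lemma PD.one {Z : ℝ} : PD Z 1 :=
  ⟨one_ne_zero, fun _ hp h1 => absurd (Nat.dvd_one.1 h1) hp.ne_one⟩

lemma PD.prime_le {Z : ℝ} (hZ : 0 ≤ Z) {m p : ℕ} (h : PD Z m) (hp : p.Prime) (hpm : p ∣ m) :
    (p : ℝ) ≤ Z * m := by
  obtain ⟨d, hd, -, h2⟩ := h.2 p hp hpm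
  have : (d : ℝ) ≤ m := by exact_mod_cast Nat.le_of_dvd (Nat.pos_of_ne_zero h.1) hd
  exact h2.trans (by gcongr)

lemma PD.mul_prime {Z : ℝ} {m p : ℕ} (h : PD Z m) (hp : p.Prime) (hpm : (p : ℝ) ≤ Z * m) :
    PD Z (m * p) := by
  classical
  refine ⟨mul_ne_zero h.1 hp.ne_zero, fun q hq hqd => ?_⟩
  by_cases hqm : q ∣ m
  · obtain ⟨d, hd, h1, h2⟩ := h.2 q hq hqm
    exact ⟨d, Dvd.dvd.mul_right hd p, h1, h2⟩
  · have hqp : q = p := by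
      rcases (Nat.Prime.dvd_mul hq).1 hqd with h1 | h1
      · exact absurd h1 hqm
      · exact (Nat.prime_dvd_prime_iff_eq hq hp).1 h1
    subst hqp
    by_cases hex : ∃ p', q ≤ p' ∧ p'.Prime ∧ p' ∣ m
    · obtain ⟨hs1, hs2, hs3⟩ := Nat.find_spec hex
      obtain ⟨d, hd, h1, h2⟩ := h.2 _ hs2 hs3
      refine ⟨d, Dvd.dvd.mul_right hd q, fun q' hq' hq'd => ?_, le_trans (by exact_mod_cast hs1) h2⟩
      by_contra hcon
      push Not at hcon
      exact Nat.find_min hex (h1 q' hq' hq'd) ⟨hcon, hq', hq'd.trans hd⟩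
    · push Not at hex
      refine ⟨m, Dvd.intro _ rfl, fun q' hq' hq'd => ?_, hpm⟩
      by_contra hcon
      push Not at hcon
      exact hex q' hcon hq' hq'd

lemma exists_decomp (Z : ℝ) {n : ℕ} (hn : n ≠ 0) :
    ∃ m r : ℕ, m * r = n ∧ PD Z m ∧ ∀ p : ℕ, p.Prime → p ∣ r → Z * m < p := by
  classical
  set A := n.divisors.filter (fun m => PD Z m) with hA
  have hne : A.Nonempty := ⟨1, by
    simp only [hA, Finset.mem_filter, Nat.mem_divisors]
    exact ⟨⟨one_dvd _, hn⟩, PD.one⟩⟩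
  obtain ⟨m, hmA, hmax⟩ := A.exists_max_image id hne
  simp only [hA, Finset.mem_filter, Nat.mem_divisors] at hmA
  obtain ⟨⟨⟨r, hr⟩, _⟩, hm⟩ := hmA
  refine ⟨m, r, hr.symm, hm, fun p hp hpr => ?_⟩
  by_contra hcon
  push Not at hcon
  have hmem : m * p ∈ A := by
    simp only [hA, Finset.mem_filter, Nat.mem_divisors]
    exact ⟨⟨hr ▸ Nat.mul_dvd_mul_left m hpr, hn⟩, hm.mul_prime hp hcon⟩
  have := hmax _ hmem
  simp only [id] at this
  have h1 := hp.two_le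
  have h2 := Nat.pos_of_ne_zero hm.1
  nlinarith

lemma decomp_dvd {Z : ℝ} (hZ : 0 ≤ Z) {m r m' r' : ℕ} (h : m * r = m' * r') (hm : PD Z m)
    (hm'0 : m' ≠ 0)
    (hr' : ∀ p : ℕ, p.Prime → p ∣ r' → Z * m' < p) : m ∣ m' := by
  classical
  have hc : Nat.Coprime m r' := by
    by_contra hcon
    have hex : ∃ p, p.Prime ∧ p ∣ m ∧ p ∣ r' := Nat.Prime.not_coprime_iff_dvd.1 hcon
    obtain ⟨h1, h2, h3⟩ := Nat.find_spec hex
    obtain ⟨d, hd, hdl, hpd⟩ := hm.2 _ h1 h2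
    have hc : Nat.Coprime d r' := Nat.coprime_of_dvd fun q hq hqd hqr =>
      Nat.find_min hex (hdl q hq hqd) ⟨hq, hqd.trans hd, hqr⟩
    have hdm : d ∣ m' := hc.dvd_of_dvd_mul_right (h ▸ Dvd.dvd.mul_right hd r)
    have h4 : (d : ℝ) ≤ m' := by exact_mod_cast Nat.le_of_dvd (Nat.pos_of_ne_zero hm'0) hdm
    have h5 := hr' _ h1 h3
    have : Z * d ≤ Z * m' := by gcongr
    linarith
  exact hc.dvd_of_dvd_mul_right (h ▸ Dvd.intro r rfl)

/-- primes below `N` exceeding `Z m` -/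
noncomputable def bigP (Z : ℝ) (N m : ℕ) : Finset ℕ :=
  N.primesBelow.filter (fun p : ℕ => Z * m < p)

noncomputable def smallP (Z : ℝ) (N m : ℕ) : Finset ℕ :=
  N.primesBelow.filter (fun p : ℕ => ¬ (Z * m < p))

def DN (Z : ℝ) (N : ℕ) : Set ℕ := {m | PD Z m ∧ m ∈ Nat.factoredNumbers N.primesBelow}

lemma mem_fN {N m : ℕ} : m ∈ Nat.factoredNumbers N.primesBelow ↔
    ∀ p : ℕ, p.Prime → p ∣ m → p ∈ N.primesBelow := Nat.mem_factoredNumbers'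

/-- the weights -/
noncomputable def wt (Z : ℝ) (N : ℕ) (s : ℝ) (m : ℕ) : ℝ :=
  hpow s m * ∏ p ∈ smallP Z N m, (1 - hpow s p)

lemma ne_zero_of_mem {S : Finset ℕ} {m : ℕ} (h : m ∈ Nat.factoredNumbers S) : m ≠ 0 :=
  Nat.ne_zero_of_mem_factoredNumbers h

/-- the bijection -/
noncomputable def decompMap (Z : ℝ) (N : ℕ)
    (x : (Σ m : DN Z N, Nat.factoredNumbers (bigP Z N m))) : Nat.factoredNumbers N.primesBelow :=
  ⟨x.1 * x.2, Nat.mul_mem_factoredNumbers x.1.2.2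
    (Nat.factoredNumbers_mono (Finset.filter_subset _ _) x.2.2)⟩

lemma decompMap_bij {Z : ℝ} (hZ : 0 ≤ Z) (N : ℕ) : Function.Bijective (decompMap Z N) := by
  constructor
  · rintro ⟨⟨m, hm⟩, ⟨r, hr⟩⟩ ⟨⟨m', hm'⟩, ⟨r', hr'⟩⟩ heq
    have h : m * r = m' * r' := congrArg Subtype.val heq
    have h1 : ∀ p : ℕ, p.Prime → p ∣ r → Z * m < p := fun p hp hpr =>
      (Finset.mem_filter.1 (Nat.mem_factoredNumbers'.1 hr p hp hpr)).2
    have h2 : ∀ p : ℕ, p.Prime → p ∣ r' → Z * m' < p := fun p hp hpr =>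
      (Finset.mem_filter.1 (Nat.mem_factoredNumbers'.1 hr' p hp hpr)).2
    have e : m = m' := Nat.dvd_antisymm (decomp_dvd hZ h hm.1 hm'.1.1 h2)
      (decomp_dvd hZ h.symm hm'.1 hm.1.1 h1)
    subst e
    have e2 : r = r' := Nat.eq_of_mul_eq_mul_left (Nat.pos_of_ne_zero hm.1.1) h
    subst e2
    rfl
  · rintro ⟨n, hn⟩
    obtain ⟨m, r, hmr, hm, hr⟩ := exists_decomp Z (ne_zero_of_mem hn)
    have hn' := mem_fN.1 hn
    have hmf : m ∈ Nat.factoredNumbers N.primesBelow :=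
      mem_fN.2 fun p hp h => hn' p hp (hmr ▸ Dvd.dvd.mul_right h r)
    have hrf : r ∈ Nat.factoredNumbers (bigP Z N m) := by
      rw [Nat.mem_factoredNumbers']
      exact fun p hp h => Finset.mem_filter.2 ⟨hn' p hp (hmr ▸ Dvd.dvd.mul_left h m), hr p hp h⟩
    exact ⟨⟨⟨m, hm, hmf⟩, ⟨r, hrf⟩⟩, Subtype.ext hmr⟩

lemma filter_prime_bigP (Z : ℝ) (N m : ℕ) : (bigP Z N m).filter Nat.Prime = bigP Z N m :=
  Finset.filter_true_of_mem fun _ hp => (Nat.mem_primesBelow.1 (Finset.mem_filter.1 hp).1).2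

lemma filter_prime_primesBelow (N : ℕ) : N.primesBelow.filter Nat.Prime = N.primesBelow :=
  Finset.filter_true_of_mem fun _ hp => (Nat.mem_primesBelow.1 hp).2

lemma wt_hasSum {Z : ℝ} (hZ : 0 ≤ Z) (N : ℕ) {s : ℝ} (hs : 0 < s) :
    HasSum (fun m : DN Z N => wt Z N s m) 1 := by
  have h1 := hpow_hasSum hs N.primesBelow
  rw [filter_prime_primesBelow] at h1
  have hpos : ∀ p ∈ N.primesBelow, 0 < 1 - hpow s p := fun p hp => by
    linarith [hpow_lt_one hs (Nat.mem_primesBelow.1 hp).2]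
  set P := ∏ p ∈ N.primesBelow, (1 - hpow s p)⁻¹ with hP
  have h2 := (Equiv.ofBijective _ (decompMap_bij hZ N)).hasSum_iff.2 h1
  have h3 : ∀ m : DN Z N, HasSum (fun r : Nat.factoredNumbers (bigP Z N m) =>
      hpow s ((m : ℕ) * (r : ℕ))) (hpow s m * ∏ p ∈ bigP Z N m, (1 - hpow s p)⁻¹) := by
    intro m
    have := (hpow_hasSum hs (bigP Z N m)).mul_left (hpow s m)
    rw [filter_prime_bigP] at this
    simpa only [map_mul] using this
  have h4 := HasSum.sigma h2 h3
  have h5 := h4.mul_right (∏ p ∈ N.primesBelow, (1 - hpow s p))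
  have e : P * ∏ p ∈ N.primesBelow, (1 - hpow s p) = 1 := by
    rw [hP, Finset.prod_inv_distrib, inv_mul_cancel₀ (Finset.prod_pos hpos).ne']
  rw [e] at h5
  have e2 : (fun m : DN Z N => wt Z N s m) = fun m : DN Z N =>
      (hpow s m * ∏ p ∈ bigP Z N m, (1 - hpow s p)⁻¹) * ∏ p ∈ N.primesBelow, (1 - hpow s p) := by
    funext m
    rw [wt, mul_assoc]
    congr 1
    have hb : 0 < ∏ p ∈ bigP Z N m, (1 - hpow s p) :=
      Finset.prod_pos fun p hp => hpos p (Finset.mem_filter.1 hp).1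
    have h6 : (∏ p ∈ bigP Z N m, (1 - hpow s p)) * ∏ p ∈ smallP Z N m, (1 - hpow s p) =
      ∏ p ∈ N.primesBelow, (1 - hpow s p) := Finset.prod_filter_mul_prod_filter_not _ _ _
    rw [← h6, ← mul_assoc, Finset.prod_inv_distrib, inv_mul_cancel₀ hb.ne', one_mul]
  rw [e2]
  exact h5

lemma one_sub_pos {s : ℝ} (hs : 0 < s) {N p : ℕ} (hp : p ∈ N.primesBelow) : 0 < 1 - hpow s p := by
  linarith [hpow_lt_one hs (Nat.mem_primesBelow.1 hp).2]

lemma hpow_shift (δ : ℝ) {m : ℕ} (hm : m ≠ 0) :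
    hpow (1 + δ) m = hpow (1 + 2 * δ) m * (m : ℝ) ^ δ := by
  have : (0 : ℝ) < m := by positivity
  rw [hpow_apply, hpow_apply, ← Real.rpow_add this]; congr 1; ring

lemma step_factor {δ : ℝ} (hδ : 0 < δ) {p : ℕ} (hp : p.Prime) :
    (1 - hpow (1 + 2 * δ) p) * Real.exp (-(δ * (Real.log p / (p - 1)))) ≤ 1 - hpow (1 + δ) p := by
  have hp2 : (2 : ℝ) ≤ p := by exact_mod_cast hp.two_le
  have hp0 : (0 : ℝ) < p := by linarith
  have h1 := hpow_lt_one (s := 1 + δ) (by linarith) hp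
  have h2 := hpow_lt_one (s := 1 + 2 * δ) (by linarith) hp
  have hl : 0 ≤ Real.log p := Real.log_natCast_nonneg p
  have key := factor_ratio' h1 h2
  have hx : (hpow (1 + δ) p - hpow (1 + 2 * δ) p) / (1 - hpow (1 + δ) p) ≤
      δ * (Real.log p / (p - 1)) := by
    have e1 : hpow (1 + 2 * δ) p = hpow (1 + δ) p * Real.exp (-(δ * Real.log p)) := by
      rw [hpow_shift δ hp.ne_zero, mul_assoc, Real.rpow_def_of_pos hp0, ← Real.exp_add]
      rw [show Real.log p * δ + -(δ * Real.log p) = 0 by ring]; simp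
    have e2 := Real.add_one_le_exp (-(δ * Real.log p))
    have e3 : hpow (1 + δ) p ≤ 1 / p := by
      rw [hpow_apply, one_div, ← Real.rpow_neg_one]
      exact Real.rpow_le_rpow_of_exponent_le (by linarith) (by linarith)
    have e4 := hpow_nonneg (1 + δ) p
    have e5 : (1 : ℝ) / p < 1 := by rw [div_lt_one hp0]; linarith
    calc _ ≤ (1 / p * (δ * Real.log p)) / (1 - 1 / p) := by
          apply div_le_div₀ (by positivity) _ (by linarith) (by linarith)
          rw [e1]
          calc _ = hpow (1 + δ) p * (1 - Real.exp (-(δ * Real.log p))) := by ring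
            _ ≤ hpow (1 + δ) p * (δ * Real.log p) := by gcongr; linarith
            _ ≤ _ := by gcongr
      _ = _ := by
          have : (p : ℝ) - 1 ≠ 0 := by linarith
          field_simp
  set E := δ * (Real.log p / (p - 1))
  have hE : (1 - hpow (1 + δ) p)⁻¹ ≤ (1 - hpow (1 + 2 * δ) p)⁻¹ * Real.exp E :=
    key.trans (mul_le_mul_of_nonneg_left (Real.exp_le_exp.2 hx) (inv_nonneg.2 (by linarith)))
  rw [Real.exp_neg, ← div_eq_mul_inv, div_le_iff₀ (Real.exp_pos _)]
  rw [inv_eq_one_div, inv_eq_one_div, div_mul_eq_mul_div, one_mul, div_le_div_iff₀ (by linarith) (by linarith)] at hE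
  linarith

lemma wt_pos {Z : ℝ} {N : ℕ} {s : ℝ} (hs : 0 < s) {m : ℕ} (hm : m ≠ 0) : 0 < wt Z N s m :=
  mul_pos (hpow_pos s hm) (Finset.prod_pos fun p hp => one_sub_pos hs (Finset.mem_filter.1 hp).1)

lemma wt_lower {Z δ : ℝ} (hZ : 1 ≤ Z) (hδ : 0 < δ) (N : ℕ) {m : ℕ} (hm : m ≠ 0) :
    wt Z N (1 + 2 * δ) m * (1 - δ * (Real.log Z + 14)) ≤ wt Z N (1 + δ) m := by
  have hm1 : (1 : ℝ) ≤ m := by exact_mod_cast Nat.one_le_iff_ne_zero.2 hm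
  have hm0 : (0 : ℝ) < m := by linarith
  have h1 : (∏ p ∈ smallP Z N m, (1 - hpow (1 + 2 * δ) p)) *
      Real.exp (-(δ * (Real.log Z + Real.log m + 14))) ≤ ∏ p ∈ smallP Z N m, (1 - hpow (1 + δ) p) := by
    have h2 : ∏ p ∈ smallP Z N m, ((1 - hpow (1 + 2 * δ) p) *
        Real.exp (-(δ * (Real.log p / (p - 1))))) ≤ ∏ p ∈ smallP Z N m, (1 - hpow (1 + δ) p) := by
      refine Finset.prod_le_prod (fun p hp => ?_) fun p hp => ?_
      · exact mul_nonneg (one_sub_pos (by linarith) (Finset.mem_filter.1 hp).1).le (Real.exp_pos _).le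
      · exact step_factor hδ (Nat.mem_primesBelow.1 (Finset.mem_filter.1 hp).1).2
    rw [Finset.prod_mul_distrib, ← Real.exp_sum, Finset.sum_neg_distrib, ← Finset.mul_sum] at h2
    refine le_trans ?_ h2
    have h3 := mertens N (Z * m) (by nlinarith)
    rw [Real.log_mul (by linarith) hm0.ne'] at h3
    have h4 : smallP Z N m = N.primesBelow.filter (fun p : ℕ => (p : ℝ) ≤ Z * m) := by
      simp only [smallP, not_lt]
    have h5 : 0 ≤ ∏ p ∈ smallP Z N m, (1 - hpow (1 + 2 * δ) p) :=
      Finset.prod_nonneg fun p hp => (one_sub_pos (by linarith) (Finset.mem_filter.1 hp).1).le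
    refine mul_le_mul_of_nonneg_left (Real.exp_le_exp.2 ?_) h5
    rw [h4]
    exact neg_le_neg (mul_le_mul_of_nonneg_left h3 hδ.le)
  have h6 : (m : ℝ) ^ δ * Real.exp (-(δ * (Real.log Z + Real.log m + 14))) =
      Real.exp (-(δ * (Real.log Z + 14))) := by
    rw [Real.rpow_def_of_pos hm0, ← Real.exp_add]; congr 1; ring
  have h7 := Real.add_one_le_exp (-(δ * (Real.log Z + 14)))
  calc _ ≤ wt Z N (1 + 2 * δ) m * Real.exp (-(δ * (Real.log Z + 14))) :=
        mul_le_mul_of_nonneg_left (by linarith) (wt_pos (by linarith) hm).le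
    _ = hpow (1 + 2 * δ) m * (m : ℝ) ^ δ * ((∏ p ∈ smallP Z N m, (1 - hpow (1 + 2 * δ) p)) *
      Real.exp (-(δ * (Real.log Z + Real.log m + 14)))) := by rw [← h6, wt]; ring
    _ ≤ hpow (1 + 2 * δ) m * (m : ℝ) ^ δ * ∏ p ∈ smallP Z N m, (1 - hpow (1 + δ) p) := by
        apply mul_le_mul_of_nonneg_left h1
        exact mul_nonneg (hpow_nonneg _ _) (Real.rpow_nonneg hm0.le _)
    _ = _ := by rw [wt, hpow_shift δ hm]

lemma split_small_big (Z : ℝ) (N m : ℕ) (s : ℝ) :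
    (∏ p ∈ bigP Z N m, (1 - hpow s p)) * ∏ p ∈ smallP Z N m, (1 - hpow s p) =
      ∏ p ∈ N.primesBelow, (1 - hpow s p) :=
  Finset.prod_filter_mul_prod_filter_not _ _ _

lemma all_lower {δ : ℝ} (hδ : 0 < δ) (N : ℕ) :
    1 ≤ (1 + 1 / δ) * ∏ p ∈ N.primesBelow, (1 - hpow (1 + δ) p) := by
  have h := prod_upper hδ N.primesBelow
  rw [filter_prime_primesBelow, Finset.prod_inv_distrib] at h
  have hp : 0 < ∏ p ∈ N.primesBelow, (1 - hpow (1 + δ) p) :=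
    Finset.prod_pos fun p hp => one_sub_pos (by linarith) hp
  rwa [inv_le_iff_one_le_mul₀ hp] at h

lemma all_upper {δ : ℝ} (hδ : 0 < δ) (N : ℕ) (hN : Real.exp (1 / δ) ≤ N) :
    ∏ p ∈ N.primesBelow, (1 - hpow (1 + 2 * δ) p) ≤ 4 * δ := by
  have hN0 : (0 : ℝ) < N := (Real.exp_pos _).trans_le hN
  have h1 := zsum_lower (σ := 2 * δ) (by linarith) N (by exact_mod_cast hN0)
  have h2 := prod_lower (s := 1 + 2 * δ) (by linarith) N
  have h3 : (N : ℝ) ^ (-(2 * δ)) ≤ 1 / 2 := by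
    calc (N : ℝ) ^ (-(2 * δ)) ≤ (Real.exp (1 / δ)) ^ (-(2 * δ)) :=
          Real.rpow_le_rpow_of_nonpos (Real.exp_pos _) hN (by linarith)
      _ = Real.exp (-2) := by rw [← Real.exp_mul]; congr 1; field_simp
      _ ≤ 1 / 2 := by
          rw [Real.exp_neg, one_div]
          apply inv_anti₀ (by norm_num)
          linarith [Real.add_one_le_exp (2 : ℝ)]
  have hp : 0 < ∏ p ∈ N.primesBelow, (1 - hpow (1 + 2 * δ) p) :=
    Finset.prod_pos fun p hp => one_sub_pos (by linarith) hp
  rw [Finset.prod_inv_distrib] at h2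
  set P := ∏ p ∈ N.primesBelow, (1 - hpow (1 + 2 * δ) p)
  have h4 : 1 / 2 ≤ 2 * δ * P⁻¹ := by
    have := mul_le_mul_of_nonneg_left h2 (by linarith : 0 ≤ 2 * δ)
    linarith
  have h5 := mul_le_mul_of_nonneg_right h4 hp.le
  rw [mul_assoc, inv_mul_cancel₀ hp.ne'] at h5
  linarith

lemma wt_upper {Z δ : ℝ} (hδ : 0 < δ) (hδ1 : δ ≤ 1) (N : ℕ) (hN : Real.exp (1 / δ) ≤ N)
    {m : ℕ} (hm : m ≠ 0) (hm16 : 16 ≤ (m : ℝ) ^ δ) :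
    wt Z N (1 + 2 * δ) m ≤ wt Z N (1 + δ) m / 2 := by
  have h1 := all_lower hδ N
  have h2 := all_upper hδ N hN
  have hall1 : 0 < ∏ p ∈ N.primesBelow, (1 - hpow (1 + δ) p) :=
    Finset.prod_pos fun p hp => one_sub_pos (by linarith) hp
  have h3 : ∏ p ∈ N.primesBelow, (1 - hpow (1 + 2 * δ) p) ≤
      8 * ∏ p ∈ N.primesBelow, (1 - hpow (1 + δ) p) := by
    calc _ ≤ 4 * δ * 1 := by linarith
      _ ≤ 4 * δ * ((1 + 1 / δ) * ∏ p ∈ N.primesBelow, (1 - hpow (1 + δ) p)) := by gcongr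
      _ = (4 * δ + 4) * ∏ p ∈ N.primesBelow, (1 - hpow (1 + δ) p) := by field_simp
      _ ≤ _ := by gcongr; linarith
  rw [← split_small_big Z N m, ← split_small_big Z N m] at h3
  have hb : 0 < ∏ p ∈ bigP Z N m, (1 - hpow (1 + 2 * δ) p) :=
    Finset.prod_pos fun p hp => one_sub_pos (by linarith) (Finset.mem_filter.1 hp).1
  have hs : 0 < ∏ p ∈ smallP Z N m, (1 - hpow (1 + δ) p) :=
    Finset.prod_pos fun p hp => one_sub_pos (by linarith) (Finset.mem_filter.1 hp).1
  have hbb : ∏ p ∈ bigP Z N m, (1 - hpow (1 + δ) p) ≤ ∏ p ∈ bigP Z N m, (1 - hpow (1 + 2 * δ) p) := by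
    refine Finset.prod_le_prod (fun p hp => ?_) fun p hp => ?_
    · exact (one_sub_pos (by linarith) (Finset.mem_filter.1 hp).1).le
    · have hp' := (Nat.mem_primesBelow.1 (Finset.mem_filter.1 hp).1).2
      have : hpow (1 + 2 * δ) p ≤ hpow (1 + δ) p :=
        Real.rpow_le_rpow_of_exponent_le (by exact_mod_cast hp'.one_lt.le) (by linarith)
      linarith
  have h4 : ∏ p ∈ smallP Z N m, (1 - hpow (1 + 2 * δ) p) ≤
      8 * ∏ p ∈ smallP Z N m, (1 - hpow (1 + δ) p) := by
    refine le_of_mul_le_mul_left (h3.trans ?_) hb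
    have := mul_le_mul_of_nonneg_right hbb hs.le
    linarith
  rw [wt, wt, hpow_shift δ hm]
  have h5 := hpow_pos (1 + 2 * δ) hm
  calc _ ≤ hpow (1 + 2 * δ) m * (8 * ∏ p ∈ smallP Z N m, (1 - hpow (1 + δ) p)) := by gcongr
    _ = hpow (1 + 2 * δ) m * 16 * (∏ p ∈ smallP Z N m, (1 - hpow (1 + δ) p)) / 2 := by ring
    _ ≤ _ := by gcongr

lemma wt_ge {Z δ : ℝ} (hδ : 0 < δ) (hδ1 : δ ≤ 1) (N m : ℕ) :
    δ / 2 * hpow (1 + δ) m ≤ wt Z N (1 + δ) m := by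
  have h1 := all_lower hδ N
  have hs : 0 < ∏ p ∈ smallP Z N m, (1 - hpow (1 + δ) p) :=
    Finset.prod_pos fun p hp => one_sub_pos (by linarith) (Finset.mem_filter.1 hp).1
  have h2 : ∏ p ∈ N.primesBelow, (1 - hpow (1 + δ) p) ≤ ∏ p ∈ smallP Z N m, (1 - hpow (1 + δ) p) := by
    rw [← split_small_big Z N m]
    refine mul_le_of_le_one_left hs.le (Finset.prod_le_one (fun p hp => ?_) fun p hp => ?_)
    · exact (one_sub_pos (by linarith) (Finset.mem_filter.1 hp).1).le
    · linarith [hpow_nonneg (1 + δ) p]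
  have h3 : δ / 2 ≤ ∏ p ∈ smallP Z N m, (1 - hpow (1 + δ) p) := by
    have h4 : 1 ≤ (1 + 1 / δ) * ∏ p ∈ smallP Z N m, (1 - hpow (1 + δ) p) := h1.trans (by gcongr)
    have h5 : δ * 1 ≤ δ * ((1 + 1 / δ) * ∏ p ∈ smallP Z N m, (1 - hpow (1 + δ) p)) := by gcongr
    have h6 : δ * ((1 + 1 / δ) * ∏ p ∈ smallP Z N m, (1 - hpow (1 + δ) p)) =
      (1 + δ) * ∏ p ∈ smallP Z N m, (1 - hpow (1 + δ) p) := by field_simp; ring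
    nlinarith
  rw [wt, mul_comm]
  exact mul_le_mul_of_nonneg_left h3 (hpow_nonneg _ _)

lemma step1_core {Z δ : ℝ} (hZ : 1 ≤ Z) (hδ : 0 < δ) (hδ1 : δ ≤ 1) (N : ℕ)
    (hN : Real.exp (1 / δ) ≤ N) (F : Finset ℕ)
    (hF : ∀ m ∈ F, m ∈ DN Z N ∧ 16 ≤ (m : ℝ) ^ δ) :
    ∑ m ∈ F, hpow (1 + δ) m ≤ 4 * (Real.log Z + 14) := by
  classical
  set B := δ * (Real.log Z + 14) with hB
  have hB0 : 0 ≤ B := mul_nonneg hδ.le (by linarith [Real.log_nonneg hZ])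
  have h1 := wt_hasSum (Z := Z) (by linarith) N (s := 1 + δ) (by linarith)
  have h2 := wt_hasSum (Z := Z) (by linarith) N (s := 1 + 2 * δ) (by linarith)
  have h3 := h1.sub (h2.mul_right (1 - B))
  have hle := sum_le_hasSum (F.subtype (· ∈ DN Z N)) (fun m _ => by
    have := wt_lower hZ hδ N m.2.1.1
    simp only [sub_nonneg]
    exact this) h3
  rw [Finset.sum_subtype_eq_sum_filter
    (f := fun m => wt Z N (1 + δ) m - wt Z N (1 + 2 * δ) m * (1 - B)),
    Finset.filter_true_of_mem fun m hm => (hF m hm).1] at hle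
  have h4 : ∑ m ∈ F, δ / 4 * hpow (1 + δ) m ≤ B := by
    refine (Finset.sum_le_sum fun m hm => ?_).trans (hle.trans (le_of_eq (by ring)))
    have hm0 := (hF m hm).1.1.1
    have := wt_upper (Z := Z) hδ hδ1 N hN hm0 (hF m hm).2
    have := wt_ge (Z := Z) hδ hδ1 N m
    have := wt_pos (Z := Z) (N := N) (s := 1 + 2 * δ) (by linarith) hm0
    nlinarith
  rw [← Finset.mul_sum] at h4
  have h5 : δ * (∑ m ∈ F, hpow (1 + δ) m) ≤ δ * (4 * (Real.log Z + 14)) := by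
    rw [hB] at h4; linarith
  exact le_of_mul_le_mul_left h5 hδ

lemma harm {X : ℝ} (hX : 1 ≤ X) (F : Finset ℕ) (hF : ∀ m ∈ F, m ≠ 0 ∧ (m : ℝ) ≤ X) :
    ∑ m ∈ F, (1 : ℝ) / m ≤ 1 + Real.log X := by
  have h1 : F ⊆ Finset.Icc 1 ⌊X⌋₊ := fun m hm => by
    rw [Finset.mem_Icc]
    exact ⟨Nat.one_le_iff_ne_zero.2 (hF m hm).1, Nat.le_floor (hF m hm).2⟩
  have h2 := harmonic_floor_le_one_add_log X hX
  rw [harmonic_eq_sum_Icc] at h2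
  push_cast at h2
  refine le_trans ?_ h2
  simp only [one_div]
  exact Finset.sum_le_sum_of_subset_of_nonneg h1 fun _ _ _ => by positivity

lemma step1 : ∃ C : ℝ, 0 < C ∧ ∀ Z X : ℝ, 2 ≤ Z → 1 ≤ X → ∀ F : Finset ℕ,
    (∀ m ∈ F, PD Z m ∧ (m : ℝ) ≤ X ∧ X ≤ Z * m ^ 2) → ∑ m ∈ F, (1 : ℝ) / m ≤ C * Real.log Z := by
  refine ⟨500000, by norm_num, fun Z X hZ hX F hF => ?_⟩
  have hlZ : 0.69 < Real.log Z :=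
    lt_of_lt_of_le (by linarith [Real.log_two_gt_d9]) (Real.log_le_log (by norm_num) hZ)
  have l16 : Real.log 16 = 4 * Real.log 2 := by
    rw [show (16 : ℝ) = 2 ^ 4 by norm_num, Real.log_pow]; norm_num
  have l2 := Real.log_two_lt_d9
  have l2' := Real.log_two_gt_d9
  have hlX0 := Real.log_nonneg hX
  by_cases hc : Real.log X ≤ 3 * Real.log Z ∨ Real.log X ≤ 3 * Real.log 16
  · have := harm hX F fun m hm => ⟨(hF m hm).1.1, (hF m hm).2.1⟩
    rcases hc with hc | hc <;> linarith
  · push Not at hc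
    obtain ⟨hc1, hc2⟩ := hc
    have hlX : 0 < Real.log X := by linarith
    set δ := 3 * Real.log 16 / Real.log X with hδd
    have hδ : 0 < δ := by rw [hδd]; apply div_pos <;> linarith
    have hδ1 : δ ≤ 1 := by rw [hδd, div_le_one hlX]; linarith
    have hδX : δ * Real.log X = 3 * Real.log 16 := by rw [hδd]; field_simp
    have hN : Real.exp (1 / δ) ≤ ((⌊X⌋₊ + 1 : ℕ) : ℝ) := by
      have h1 : X ≤ ((⌊X⌋₊ + 1 : ℕ) : ℝ) := by push_cast; exact (Nat.lt_floor_add_one X).le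
      refine le_trans ?_ h1
      rw [← Real.le_log_iff_exp_le (by linarith), div_le_iff₀ hδ]
      nlinarith
    have hlm : ∀ m ∈ F, Real.log X / 3 ≤ Real.log m ∧ Real.log m ≤ Real.log X ∧ (0 : ℝ) < m := by
      intro m hm
      obtain ⟨h1, h2, h3⟩ := hF m hm
      have hm0 : (0 : ℝ) < m := by exact_mod_cast Nat.pos_of_ne_zero h1.1
      have h4 := Real.log_le_log (by linarith) h3
      rw [Real.log_mul (by linarith) (by positivity), Real.log_pow] at h4
      push_cast at h4
      exact ⟨by linarith, Real.log_le_log hm0 h2, hm0⟩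
    have key := step1_core (Z := Z) (by linarith) hδ hδ1 _ hN F (fun m hm => by
      obtain ⟨h1, h2, h3⟩ := hF m hm
      obtain ⟨h4, h5, hm0⟩ := hlm m hm
      refine ⟨⟨h1, mem_fN.2 fun p hp hpm => Nat.mem_primesBelow.2 ⟨?_, hp⟩⟩, ?_⟩
      · have := Nat.le_of_dvd (Nat.pos_of_ne_zero h1.1) hpm
        exact Nat.lt_succ_iff.2 (this.trans (Nat.le_floor h2))
      · rw [Real.rpow_def_of_pos hm0, ← Real.log_le_iff_le_exp (by norm_num)]
        nlinarith)
    have h6 : ∑ m ∈ F, (1 : ℝ) / m ≤ ∑ m ∈ F, 4096 * hpow (1 + δ) m := by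
      refine Finset.sum_le_sum fun m hm => ?_
      obtain ⟨h4, h5, hm0⟩ := hlm m hm
      have e : hpow (1 + δ) m = 1 / m * Real.exp (-(δ * Real.log m)) := by
        rw [hpow_apply, show -(1 + δ) = -1 + -δ by ring, Real.rpow_add hm0, Real.rpow_neg_one,
          one_div, Real.rpow_def_of_pos hm0]; congr 2; ring
      have e2 : (1 / 4096 : ℝ) ≤ Real.exp (-(δ * Real.log m)) := by
        rw [← Real.log_le_iff_le_exp (by norm_num), one_div, Real.log_inv,
          show (4096 : ℝ) = 16 ^ 3 by norm_num, Real.log_pow]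
        push_cast
        nlinarith
      have : (0 : ℝ) < 1 / m := by positivity
      rw [e]; nlinarith
    rw [← Finset.mul_sum] at h6
    linarith

open Classical in
/-- the starting parts `m` at height `X` -/
noncomputable def WS (Z X : ℝ) : Finset ℕ :=
  (Finset.Icc 1 ⌊X⌋₊).filter (fun m : ℕ => PD Z m ∧ X ≤ Z * (m : ℝ) ^ 2)

/-- lower bound for the primes that may follow `m` -/
noncomputable def Q0 (X : ℝ) (m : ℕ) : ℝ := max ((m.primeFactors.sup id : ℕ) : ℝ) (X / m)

noncomputable def lQ (X : ℝ) (m : ℕ) : ℝ := Real.log (max 8 (Q0 X m))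

noncomputable def WW (Z X : ℝ) : ℝ := ∑ m ∈ WS Z X, 1 / (m : ℝ) * (1 / lQ X m)

lemma mem_WS {Z X : ℝ} (hX : 0 ≤ X) {m : ℕ} :
    m ∈ WS Z X ↔ PD Z m ∧ (m : ℝ) ≤ X ∧ X ≤ Z * (m : ℝ) ^ 2 := by
  classical
  rw [WS, Finset.mem_filter, Finset.mem_Icc, Nat.le_floor_iff hX]
  constructor
  · rintro ⟨⟨_, h2⟩, h3, h4⟩; exact ⟨h3, h2, h4⟩
  · rintro ⟨h3, h2, h4⟩; exact ⟨⟨Nat.one_le_iff_ne_zero.2 h3.1, h2⟩, h3, h4⟩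

lemma two_lt_lQ (X : ℝ) (m : ℕ) : 2 < lQ X m :=
  log8.trans_le (Real.log_le_log (by norm_num) (le_max_left _ _))

lemma PD.split_WS {Z : ℝ} {n : ℕ} (h : PD Z n) {Y : ℝ} (hY : 1 ≤ Y) (hYn : Y < n) (hZ : 0 ≤ Z) :
    ∃ m r : ℕ, m * r = n ∧ m ∈ WS Z Y ∧ ∀ p : ℕ, p.Prime → p ∣ r → Q0 Y m ≤ p := by
  obtain ⟨m, r, h1, h2, h3, h4, h5⟩ := h.split hY hYn hZ
  refine ⟨m, r, h1, (mem_WS (by linarith)).2 ⟨h2, h3, h4⟩, fun p hp hpr => ?_⟩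
  obtain ⟨h6, h7⟩ := h5 p hp hpr
  refine max_le ?_ h6
  exact_mod_cast Finset.sup_le fun q hq =>
    h7 q (Nat.prime_of_mem_primeFactors hq) (Nat.dvd_of_mem_primeFactors hq)

lemma prime_le_Q0 {X : ℝ} {m p : ℕ} (hm : m ≠ 0) (hp : p.Prime) (hpm : p ∣ m) : (p : ℝ) ≤ Q0 X m := by
  refine le_max_of_le_left ?_
  exact_mod_cast Finset.le_sup (f := id) (Nat.mem_primeFactors.2 ⟨hp, hpm, hm⟩)

open Classical in
lemma T_bound {Z X : ℝ} (hZ : 0 ≤ Z) (hX : 1 < X) {j : ℕ} (hj : 4 ≤ j) :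
    ∑ m ∈ (WS Z X).filter (fun m => lQ X m ≤ Real.log X / j), (1 : ℝ) / m ≤
      Real.exp (-(j : ℝ) / 4) * (8 * Real.exp 200 * (Real.log X / j)) * WW Z (Real.sqrt X) := by
  set T := (WS Z X).filter (fun m => lQ X m ≤ Real.log X / j) with hT
  have hj4 : (4 : ℝ) ≤ j := by exact_mod_cast hj
  have hj0 : (0 : ℝ) < j := by linarith
  have hL : 0 < Real.log X := Real.log_pos hX
  set L := Real.log X with hLd
  set y := Real.exp (L / j) with hy
  have hly : Real.log y = L / j := Real.log_exp _
  have hlyL : L / j ≤ L / 4 := by gcongr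
  have hy0 : 0 < L / j := by positivity
  set Y := Real.sqrt X with hYd
  have hY1 : 1 ≤ Y := Real.one_le_sqrt.2 hX.le
  have hY0 : 0 < Y := by linarith
  have hlY : Real.log Y = L / 2 := Real.log_sqrt (by linarith)
  have hTm : ∀ n ∈ T, PD Z n ∧ (0 : ℝ) < n ∧ 8 ≤ y ∧ Q0 X n ≤ y ∧ L - L / j ≤ Real.log n := by
    intro n hn
    rw [hT, Finset.mem_filter, mem_WS (by linarith)] at hn
    obtain ⟨⟨h1, h2, h3⟩, h4⟩ := hn
    have hn0 : (0 : ℝ) < n := by exact_mod_cast Nat.pos_of_ne_zero h1.1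
    have h5 : max 8 (Q0 X n) ≤ y := by
      rw [lQ, Real.log_le_iff_le_exp (lt_of_lt_of_le (by norm_num) (le_max_left _ _))] at h4
      exact h4
    have h6 : X / n ≤ y := (le_max_right _ _).trans ((le_max_right _ _).trans h5)
    refine ⟨h1, hn0, (le_max_left _ _).trans h5, (le_max_right _ _).trans h5, ?_⟩
    have h7 := Real.log_le_log (by positivity) h6
    rw [Real.log_div (by linarith) hn0.ne', hly] at h7
    linarith
  have hex : ∀ n ∈ T, ∃ m r : ℕ, m * r = n ∧ m ∈ WS Z Y ∧ ∀ p : ℕ, p.Prime → p ∣ r → Q0 Y m ≤ p := by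
    intro n hn
    obtain ⟨h1, h2, h3, h4, h5⟩ := hTm n hn
    refine h1.split_WS hY1 ?_ hZ
    rw [← Real.log_lt_log_iff hY0 h2, hlY]
    linarith
  choose! f g hfg hf hg using hex
  rw [← Finset.sum_fiberwise_of_maps_to hf, WW, Finset.mul_sum]
  refine Finset.sum_le_sum fun m hm => ?_
  set G := T.filter (fun n => f n = m) with hG
  rw [mem_WS hY0.le] at hm
  have hm0 : (0 : ℝ) < m := by exact_mod_cast Nat.pos_of_ne_zero hm.1.1
  have hlQ := two_lt_lQ Y m
  rcases G.eq_empty_or_nonempty with hE | ⟨n0, hn0⟩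
  · rw [hE, Finset.sum_empty]; positivity
  have hGm : ∀ n ∈ G, n ∈ T ∧ m * g n = n ∧ (0 : ℝ) < g n ∧ L / 4 ≤ Real.log (g n) ∧
      ∀ p : ℕ, p.Prime → p ∣ g n → Q0 Y m ≤ p ∧ (p : ℝ) ≤ y := by
    intro n hn
    rw [hG, Finset.mem_filter] at hn
    obtain ⟨hnT, rfl⟩ := hn
    have h1 := hfg n hnT
    obtain ⟨h2, h3, h4, h5, h6⟩ := hTm n hnT
    have h7 : g n ≠ 0 := fun h => h2.1 (by rw [← h1, h, mul_zero])
    have h8 : (0 : ℝ) < g n := by exact_mod_cast Nat.pos_of_ne_zero h7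
    refine ⟨hnT, h1, h8, ?_, fun p hp hpg => ⟨hg n hnT p hp hpg, ?_⟩⟩
    · have h9 : Real.log n = Real.log (f n) + Real.log (g n) := by
        rw [← Real.log_mul hm0.ne' h8.ne', ← Nat.cast_mul, h1]
      have h10 := Real.log_le_log hm0 hm.2.1
      linarith
    · exact (prime_le_Q0 h2.1 hp (h1 ▸ Dvd.dvd.mul_left hpg _)).trans h5
  have hinj : Set.InjOn g G := by
    intro a ha b hb hab
    rw [← (hGm a ha).2.1, ← (hGm b hb).2.1, hab]
  have hy8 : 8 ≤ y := (hTm n0 (hGm n0 hn0).1).2.2.1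
  have hqy : Q0 Y m ≤ y := by
    obtain ⟨h1, h2, h3, h4, h5⟩ := hGm n0 hn0
    have h6 : g n0 ≠ 1 := fun h => by rw [h] at h4; simp at h4; linarith
    obtain ⟨p, hp, hpg⟩ := Nat.exists_prime_and_dvd h6
    exact (h5 p hp hpg).1.trans (h5 p hp hpg).2
  have key := rough_sum (δ := 1 / Real.log y) hy8 hqy (by rw [hly]; positivity) le_rfl (G.image g)
    (by
      intro t ht
      obtain ⟨n, hn, rfl⟩ := Finset.mem_image.1 ht
      obtain ⟨h1, h2, h3, h4, h5⟩ := hGm n hn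
      exact ⟨by exact_mod_cast h3.ne', h5⟩)
  rw [Finset.sum_image hinj] at key
  have hlast : ∑ n ∈ G, (1 : ℝ) / n ≤
      1 / (m : ℝ) * Real.exp (-(j : ℝ) / 4) * ∑ n ∈ G, hpow (1 - 1 / Real.log y) (g n) := by
    rw [Finset.mul_sum]
    refine Finset.sum_le_sum fun n hn => ?_
    obtain ⟨h1, h2, h3, h4, h5⟩ := hGm n hn
    have e1 : (n : ℝ) = m * g n := by exact_mod_cast h2.symm
    have e2 : hpow (1 - 1 / Real.log y) (g n) =
        1 / (g n : ℝ) * Real.exp (j / L * Real.log (g n)) := by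
      rw [hpow_apply, hly, show -(1 - 1 / (L / j)) = -1 + j / L by field_simp; ring,
        Real.rpow_add h3, Real.rpow_neg_one, one_div, Real.rpow_def_of_pos h3, mul_comm (Real.log _)]
    have e3 : 1 ≤ Real.exp (-(j : ℝ) / 4) * Real.exp (j / L * Real.log (g n)) := by
      rw [← Real.exp_add]
      apply Real.one_le_exp
      have : (j : ℝ) / L * (L / 4) ≤ j / L * Real.log (g n) := by gcongr
      have e4 : (j : ℝ) / L * (L / 4) = j / 4 := by field_simp
      linarith
    rw [e2, e1]
    calc (1 : ℝ) / (m * g n) = 1 / (m : ℝ) * (1 / g n) * 1 := by field_simp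
      _ ≤ 1 / (m : ℝ) * (1 / g n) * (Real.exp (-(j : ℝ) / 4) * Real.exp (j / L * Real.log (g n))) := by
          gcongr
      _ = _ := by ring
  refine hlast.trans ?_
  calc _ ≤ 1 / (m : ℝ) * Real.exp (-(j : ℝ) / 4) *
        (8 * Real.exp 200 * Real.log y / Real.log (max 8 (Q0 Y m))) := by gcongr
    _ = _ := by rw [hly, lQ]; ring

lemma WW_nonneg (Z X : ℝ) : 0 ≤ WW Z X :=
  Finset.sum_nonneg fun m _ => by have := two_lt_lQ X m; positivity

open Classical in
lemma inv_lQ_le {X : ℝ} (hX : 1 < X) {K : ℕ} (hK : 1 ≤ K) (m : ℕ) :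
    1 / lQ X m ≤ K / Real.log X + ∑ j ∈ Finset.Ico K (⌊Real.log X⌋₊ + 1),
      (if lQ X m ≤ Real.log X / j then 2 * j / Real.log X else 0) := by
  have hL : 0 < Real.log X := Real.log_pos hX
  have hq := two_lt_lQ X m
  set L := Real.log X
  have hK1 : (1 : ℝ) ≤ K := by exact_mod_cast hK
  have hnn : ∀ j ∈ Finset.Ico K (⌊L⌋₊ + 1), 0 ≤ (if lQ X m ≤ L / j then 2 * j / L else 0) := by
    intro j _; split_ifs <;> positivity
  by_cases hc : L / lQ X m < K
  · have h1 : 1 / lQ X m ≤ K / L := by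
      rw [div_le_div_iff₀ (by linarith) hL]
      rw [div_lt_iff₀ (by linarith)] at hc
      linarith
    linarith [Finset.sum_nonneg hnn]
  · push Not at hc
    set j := ⌊L / lQ X m⌋₊ with hj
    have hKj : K ≤ j := Nat.le_floor hc
    have hj1 : (1 : ℝ) ≤ j := by exact_mod_cast hK.trans hKj
    have h1 : (j : ℝ) ≤ L / lQ X m := Nat.floor_le (by positivity)
    have h2 : L / lQ X m < j + 1 := Nat.lt_floor_add_one _
    have h3 : j ∈ Finset.Ico K (⌊L⌋₊ + 1) := by
      rw [Finset.mem_Ico, Nat.lt_succ_iff]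
      refine ⟨hKj, Nat.floor_mono ?_⟩
      exact div_le_self hL.le (by linarith)
    have h4 := Finset.single_le_sum hnn h3
    have h5 : lQ X m ≤ L / j := by
      rw [le_div_iff₀ (by linarith)]
      rw [le_div_iff₀ (by linarith)] at h1
      linarith
    rw [if_pos h5] at h4
    refine le_trans ?_ (h4.trans (le_add_of_nonneg_left (by positivity)))
    rw [div_le_div_iff₀ (by linarith) hL]
    rw [div_lt_iff₀ (by linarith)] at h2
    nlinarith

lemma exists_K : ∃ K : ℕ, 4 ≤ K ∧ ∀ J : ℕ,
    16 * Real.exp 200 * ∑ j ∈ Finset.Ico K J, Real.exp (-(j : ℝ) / 4) ≤ 1 / 4 := by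
  set ρ := Real.exp (-1 / 4) with hρ
  have h1 : ρ < 1 := (Real.exp_lt_exp.2 (by norm_num)).trans_eq Real.exp_zero
  have h0 : 0 < ρ := Real.exp_pos _
  obtain ⟨k, hk⟩ := exists_pow_lt_of_lt_one (y := ρ)
    (show (0 : ℝ) < (1 - ρ) * (1 / 4 / (16 * Real.exp 200)) from
      mul_pos (by linarith) (by positivity)) h1
  refine ⟨k + 4, by omega, fun J => ?_⟩
  have h2 : ∀ j : ℕ, Real.exp (-(j : ℝ) / 4) = ρ ^ j := fun j => by
    rw [hρ, ← Real.exp_nat_mul]; congr 1; ring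
  simp only [h2]
  have h3 := geom_sum_Ico_le_of_lt_one (m := k + 4) (n := J) h0.le h1
  have h4 : ρ ^ (k + 4) ≤ ρ ^ k := pow_le_pow_of_le_one h0.le h1.le (by omega)
  have h5 : ρ ^ (k + 4) / (1 - ρ) ≤ 1 / 4 / (16 * Real.exp 200) := by
    rw [div_le_iff₀ (by linarith)]; linarith
  have h6 := h3.trans h5
  rw [le_div_iff₀ (by positivity)] at h6
  linarith

lemma WW_rec {Z X : ℝ} (hZ : 0 ≤ Z) (hX : 1 < X) {K : ℕ} (hK : 4 ≤ K) :
    WW Z X ≤ K / Real.log X * ∑ m ∈ WS Z X, (1 : ℝ) / m +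
      16 * Real.exp 200 * (∑ j ∈ Finset.Ico K (⌊Real.log X⌋₊ + 1), Real.exp (-(j : ℝ) / 4)) *
        WW Z (Real.sqrt X) := by
  classical
  have hL : 0 < Real.log X := Real.log_pos hX
  calc WW Z X ≤ ∑ m ∈ WS Z X, 1 / (m : ℝ) * (K / Real.log X +
        ∑ j ∈ Finset.Ico K (⌊Real.log X⌋₊ + 1),
          (if lQ X m ≤ Real.log X / j then 2 * j / Real.log X else 0)) := by
        refine Finset.sum_le_sum fun m _ => ?_
        exact mul_le_mul_of_nonneg_left (inv_lQ_le hX (by omega) m) (by positivity)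
    _ = K / Real.log X * ∑ m ∈ WS Z X, (1 : ℝ) / m +
        ∑ j ∈ Finset.Ico K (⌊Real.log X⌋₊ + 1), 2 * j / Real.log X *
          ∑ m ∈ (WS Z X).filter (fun m => lQ X m ≤ Real.log X / j), (1 : ℝ) / m := by
        simp only [mul_add, Finset.sum_add_distrib, Finset.mul_sum]
        congr 1
        · exact Finset.sum_congr rfl fun m _ => mul_comm _ _
        · rw [Finset.sum_comm]
          refine Finset.sum_congr rfl fun j _ => ?_
          rw [Finset.sum_filter]
          refine Finset.sum_congr rfl fun m _ => ?_
          split_ifs <;> ring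
    _ ≤ _ := by
        gcongr
        rw [mul_assoc, mul_comm (∑ j ∈ _, _), ← mul_assoc, Finset.mul_sum]
        refine Finset.sum_le_sum fun j hj => ?_
        have hj4 : 4 ≤ j := hK.trans (Finset.mem_Ico.1 hj).1
        have hj0 : (0 : ℝ) < j := by exact_mod_cast (by omega : 0 < j)
        calc _ ≤ 2 * j / Real.log X * (Real.exp (-(j : ℝ) / 4) *
            (8 * Real.exp 200 * (Real.log X / j)) * WW Z (Real.sqrt X)) :=
              mul_le_mul_of_nonneg_left (T_bound hZ hX hj4) (by positivity)
          _ = _ := by field_simp; ring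

lemma WW_bound : ∃ C : ℝ, 0 < C ∧ ∀ Z X : ℝ, 2 ≤ Z → 2 ≤ X →
    WW Z X ≤ C * Real.log Z / Real.log X := by
  obtain ⟨C1, hC1, h1⟩ := step1
  obtain ⟨K, hK, hKJ⟩ := exists_K
  have hKR : (4 : ℝ) ≤ K := by exact_mod_cast hK
  set C := 4 + 2 * K * C1 with hC
  have hC0 : 0 < C := by positivity
  have hl2 := Real.log_two_gt_d9
  have hl2' := Real.log_two_lt_d9
  refine ⟨C, hC0, fun Z X hZ hX => ?_⟩
  have hlZ : Real.log 2 ≤ Real.log Z := Real.log_le_log (by norm_num) hZ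
  have hlZ0 : 0 < Real.log Z := by linarith
  have main : ∀ n : ℕ, ∀ X : ℝ, 2 ≤ X → X ≤ 2 ^ (2 ^ n) → WW Z X ≤ C * Real.log Z / Real.log X := by
    intro n
    have small : ∀ X : ℝ, 2 ≤ X → X ≤ 4 → WW Z X ≤ C * Real.log Z / Real.log X := by
      intro X hX hX4
      have hl4 : Real.log 4 = 2 * Real.log 2 := by
        rw [show (4 : ℝ) = 2 ^ 2 by norm_num, Real.log_pow]; norm_num
      have h2 := Real.log_le_log (by linarith) hX4
      have h3 : 0 < Real.log X := Real.log_pos (by linarith)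
      have h4 : WW Z X ≤ ∑ m ∈ WS Z X, (1 : ℝ) / m * (1 / 2) := by
        refine Finset.sum_le_sum fun m _ => ?_
        have := two_lt_lQ X m
        gcongr
      rw [← Finset.sum_mul] at h4
      have h5 := harm (X := X) (by linarith) (WS Z X) fun m hm => by
        rw [mem_WS (by linarith)] at hm
        exact ⟨hm.1.1, hm.2.1⟩
      rw [le_div_iff₀ h3]
      have h6 : WW Z X ≤ 2 := by linarith
      have h7 : 4 * Real.log Z ≤ C * Real.log Z := by
        gcongr; rw [hC]; have : 0 < 2 * K * C1 := by positivity
        linarith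
      nlinarith
    induction n with
    | zero => intro X hX hX2; exact small X hX (by norm_num at hX2; linarith)
    | succ n ih =>
      intro X hX hX2
      by_cases h4 : X ≤ 4
      · exact small X hX h4
      push Not at h4
      have h3 : 0 < Real.log X := Real.log_pos (by linarith)
      have hs2 : 2 ≤ Real.sqrt X := Real.le_sqrt_of_sq_le (by linarith)
      have hsn : Real.sqrt X ≤ 2 ^ (2 ^ n) := by
        apply Real.sqrt_le_iff.2 ⟨by positivity, ?_⟩
        rw [← pow_mul, ← pow_succ]; exact hX2
      have h5 := ih _ hs2 hsn
      have h6 := WW_rec (Z := Z) (X := X) (by linarith) (by linarith) hK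
      have h7 := h1 Z X hZ (by linarith) (WS Z X) fun m hm => (mem_WS (by linarith)).1 hm
      have h8 := hKJ (⌊Real.log X⌋₊ + 1)
      rw [Real.log_sqrt (by linarith)] at h5
      calc WW Z X ≤ K / Real.log X * (C1 * Real.log Z) +
            1 / 4 * (C * Real.log Z / (Real.log X / 2)) := by
            refine h6.trans (add_le_add ?_ ?_)
            · gcongr
            · exact mul_le_mul h8 h5 (WW_nonneg _ _) (by norm_num)
        _ = (K * C1 + C / 2) * Real.log Z / Real.log X := by field_simp; ring
        _ ≤ _ := by
            gcongr
            rw [hC]; linarith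
  obtain ⟨n, hn⟩ := pow_unbounded_of_one_lt X (by norm_num : (1 : ℝ) < 2)
  refine main n X hX (hn.le.trans ?_)
  exact pow_le_pow_right₀ (by norm_num) Nat.lt_two_pow_self.le

open ArithmeticFunction in
lemma log_sum {U q x : ℝ} (hU : 0 ≤ U) (hUx : U ≤ x) (hx : 8 ≤ x) (hq : q ≤ x) (R : Finset ℕ)
    (hR : ∀ r ∈ R, r ≠ 0 ∧ (r : ℝ) ≤ U ∧ ∀ p : ℕ, p.Prime → p ∣ r → q ≤ p) :
    ∑ r ∈ R, Real.log r ≤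
      (Real.log 4 + 4) * U * (8 * Real.exp 200 * Real.log x / Real.log (max 8 q)) := by
  classical
  set S := (Finset.Icc 1 ⌊U⌋₊).filter (fun t : ℕ => ∀ p : ℕ, p.Prime → p ∣ t → q ≤ p) with hS
  have hl4 : 0 < Real.log 4 := Real.log_pos (by norm_num)
  have h1 : ∀ r ∈ R, Real.log r = ∑ t ∈ S, if t ∣ r then Λ (r / t) else 0 := by
    intro r hr
    obtain ⟨h0, h2, h3⟩ := hR r hr
    rw [← vonMangoldt_sum, ← Nat.sum_div_divisors, ← Finset.sum_filter]
    refine Finset.sum_congr ?_ fun _ _ => rfl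
    ext t
    rw [Nat.mem_divisors, Finset.mem_filter, hS, Finset.mem_filter, Finset.mem_Icc]
    constructor
    · rintro ⟨h4, _⟩
      have h5 : t ≤ r := Nat.le_of_dvd (Nat.pos_of_ne_zero h0) h4
      have h6 : (t : ℝ) ≤ r := by exact_mod_cast h5
      exact ⟨⟨⟨Nat.pos_of_dvd_of_pos h4 (Nat.pos_of_ne_zero h0), Nat.le_floor (h6.trans h2)⟩,
        fun p hp hpt => h3 p hp (hpt.trans h4)⟩, h4⟩
    · rintro ⟨_, h4⟩; exact ⟨h4, h0⟩
  rw [Finset.sum_congr rfl h1, Finset.sum_comm]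
  have h2 : ∀ t ∈ S, (∑ r ∈ R, if t ∣ r then Λ (r / t) else 0) ≤ (Real.log 4 + 4) * U * hpow (1 - 0) t := by
    intro t ht
    rw [hS, Finset.mem_filter, Finset.mem_Icc] at ht
    have ht0 : (0 : ℝ) < t := by exact_mod_cast ht.1.1
    rw [← Finset.sum_filter]
    have hinj : Set.InjOn (fun r => r / t) (R.filter (fun r => t ∣ r)) := by
      intro a ha b hb hab
      have ha' := (Finset.mem_filter.1 ha).2
      have hb' := (Finset.mem_filter.1 hb).2
      rw [← Nat.div_mul_cancel ha', ← Nat.div_mul_cancel hb']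
      exact congrArg (· * t) hab
    rw [← Finset.sum_image (f := fun d => Λ d) hinj]
    calc _ ≤ Chebyshev.psi (U / t) := by
          rw [Chebyshev.psi]
          refine Finset.sum_le_sum_of_subset_of_nonneg (fun d hd => ?_)
            fun _ _ _ => vonMangoldt_nonneg
          obtain ⟨r, hr, rfl⟩ := Finset.mem_image.1 hd
          obtain ⟨hr, htr⟩ := Finset.mem_filter.1 hr
          obtain ⟨h0, h2, h3⟩ := hR r hr
          rw [Finset.mem_Ioc]
          refine ⟨Nat.div_pos (Nat.le_of_dvd (Nat.pos_of_ne_zero h0) htr) ht.1.1, Nat.le_floor ?_⟩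
          rw [Nat.cast_div htr ht0.ne']
          gcongr
      _ ≤ (Real.log 4 + 4) * (U / t) := Chebyshev.psi_le_const_mul_self (by positivity)
      _ = _ := by rw [hpow_apply, sub_zero, Real.rpow_neg_one]; ring
  refine (Finset.sum_le_sum h2).trans ?_
  rw [← Finset.mul_sum]
  refine mul_le_mul_of_nonneg_left ?_ (by positivity)
  have hlx : 0 < Real.log x := Real.log_pos (by linarith)
  refine rough_sum hx hq le_rfl (by positivity) S fun t ht => ?_
  rw [hS, Finset.mem_filter, Finset.mem_Icc] at ht
  refine ⟨by omega, fun p hp hpt => ⟨ht.2 p hp hpt, ?_⟩⟩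
  have h5 : (p : ℝ) ≤ t := by exact_mod_cast Nat.le_of_dvd ht.1.1 hpt
  have h6 : (t : ℝ) ≤ U := (Nat.cast_le.2 ht.1.2).trans (Nat.floor_le hU)
  linarith

lemma sum_inv_sqrt (N : ℕ) : ∑ n ∈ Finset.Icc 1 N, 1 / Real.sqrt n ≤ 2 * Real.sqrt N := by
  induction N with
  | zero => simp
  | succ N ih =>
    rw [Finset.sum_Icc_succ_top (by omega)]
    have ha : 0 < Real.sqrt ((N + 1 : ℕ) : ℝ) := Real.sqrt_pos.2 (by positivity)
    have h1 := Real.sq_sqrt (show (0 : ℝ) ≤ ((N + 1 : ℕ) : ℝ) by positivity)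
    have h2 := Real.sq_sqrt (show (0 : ℝ) ≤ (N : ℝ) by positivity)
    push_cast at h1
    have h3 : 1 / Real.sqrt ((N + 1 : ℕ) : ℝ) ≤ 2 * (Real.sqrt ((N + 1 : ℕ) : ℝ) - Real.sqrt N) := by
      rw [div_le_iff₀ ha]
      push_cast
      nlinarith [sq_nonneg (Real.sqrt ((N : ℝ) + 1) - Real.sqrt N)]
    linarith

lemma sum_log_div {x : ℝ} (hx : 1 ≤ x) (D : Finset ℕ) (hD : ∀ n ∈ D, n ≠ 0 ∧ (n : ℝ) ≤ x) :
    ∑ n ∈ D, Real.log (x / n) ≤ 4 * x := by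
  have h1 : ∀ n ∈ D, Real.log (x / n) ≤ 2 * Real.sqrt x * (1 / Real.sqrt n) := by
    intro n hn
    have hn0 : (0 : ℝ) < n := by exact_mod_cast Nat.pos_of_ne_zero (hD n hn).1
    have h2 := Real.log_le_sub_one_of_pos (Real.sqrt_pos.2 (show 0 < x / n by positivity))
    rw [Real.log_sqrt (by positivity), Real.sqrt_div (by linarith)] at h2
    have h3 : 2 * Real.sqrt x * (1 / Real.sqrt n) = 2 * (Real.sqrt x / Real.sqrt n) := by ring
    linarith
  refine (Finset.sum_le_sum h1).trans ?_
  rw [← Finset.mul_sum]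
  have h2 : D ⊆ Finset.Icc 1 ⌊x⌋₊ := fun n hn => by
    rw [Finset.mem_Icc]
    exact ⟨Nat.one_le_iff_ne_zero.2 (hD n hn).1, Nat.le_floor (hD n hn).2⟩
  have h3 : ∑ n ∈ D, 1 / Real.sqrt n ≤ 2 * Real.sqrt x :=
    ((Finset.sum_le_sum_of_subset_of_nonneg h2 fun _ _ _ => by positivity).trans
      (sum_inv_sqrt _)).trans (by
        have := Real.sqrt_le_sqrt (Nat.floor_le (show 0 ≤ x by linarith))
        linarith)
  have h4 := Real.mul_self_sqrt (show 0 ≤ x by linarith)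
  have h5 := Real.sqrt_nonneg x
  nlinarith

lemma sum_log_part {Z x : ℝ} (hZ : 0 ≤ Z) (hx : 64 ≤ x) (D : Finset ℕ)
    (hD : ∀ n ∈ D, PD Z n ∧ (n : ℝ) ≤ x ∧ Real.sqrt x < n) :
    Real.log x / 2 * D.card ≤ 4 * x +
      (Real.log 4 + 4) * (8 * Real.exp 200) * x * Real.log x * WW Z (Real.sqrt x) := by
  classical
  have hx0 : 0 < x := by linarith
  set Y := Real.sqrt x with hYd
  have hY1 : 1 ≤ Y := Real.one_le_sqrt.2 (by linarith)
  have hYx : Y ≤ x := Real.sqrt_le_iff.2 ⟨by linarith, by nlinarith⟩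
  have hlY : Real.log Y = Real.log x / 2 := Real.log_sqrt (by linarith)
  have hex : ∀ n ∈ D, ∃ m r : ℕ, m * r = n ∧ m ∈ WS Z Y ∧ ∀ p : ℕ, p.Prime → p ∣ r → Q0 Y m ≤ p :=
    fun n hn => (hD n hn).1.split_WS hY1 (hD n hn).2.2 hZ
  choose! f g hfg hf hg using hex
  have hpos : ∀ n ∈ D, (0 : ℝ) < f n ∧ (0 : ℝ) < g n ∧ (f n : ℝ) ≤ Y ∧ (n : ℝ) = f n * g n := by
    intro n hn
    have h1 := hf n hn
    rw [mem_WS (by linarith)] at h1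
    have h2 : g n ≠ 0 := fun h => (hD n hn).1.1 (by rw [← hfg n hn, h, mul_zero])
    exact ⟨by exact_mod_cast Nat.pos_of_ne_zero h1.1.1, by exact_mod_cast Nat.pos_of_ne_zero h2, h1.2.1,
      by exact_mod_cast (hfg n hn).symm⟩
  have h1 : Real.log x / 2 * D.card ≤ ∑ n ∈ D, (Real.log (x / n) + Real.log (g n)) := by
    rw [mul_comm, ← nsmul_eq_mul, ← Finset.sum_const]
    refine Finset.sum_le_sum fun n hn => ?_
    obtain ⟨a, b, c, d⟩ := hpos n hn
    rw [d, Real.log_div hx0.ne' (by positivity), Real.log_mul a.ne' b.ne']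
    have := Real.log_le_log a c
    linarith
  rw [Finset.sum_add_distrib] at h1
  have h2 := sum_log_div (x := x) (by linarith) D fun n hn => ⟨(hD n hn).1.1, (hD n hn).2.1⟩
  have h3 : ∑ n ∈ D, Real.log (g n) ≤
      (Real.log 4 + 4) * (8 * Real.exp 200) * x * Real.log x * WW Z Y := by
    rw [← Finset.sum_fiberwise_of_maps_to hf, WW, Finset.mul_sum]
    refine Finset.sum_le_sum fun m hm => ?_
    rw [mem_WS (by linarith)] at hm
    have hm0 : (0 : ℝ) < m := by exact_mod_cast Nat.pos_of_ne_zero hm.1.1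
    have hm1 : (1 : ℝ) ≤ m := by exact_mod_cast Nat.one_le_iff_ne_zero.2 hm.1.1
    set G := D.filter (fun n => f n = m) with hG
    have hinj : Set.InjOn g G := by
      intro a ha b hb hab
      obtain ⟨ha1, ha2⟩ := Finset.mem_filter.1 ha
      obtain ⟨hb1, hb2⟩ := Finset.mem_filter.1 hb
      rw [← hfg a ha1, ← hfg b hb1, hab, ha2, hb2]
    have hQ : Q0 Y m ≤ x := by
      refine max_le ?_ ((div_le_self (by linarith) hm1).trans hYx)
      refine le_trans ?_ (hm.2.1.trans hYx)
      exact_mod_cast Finset.sup_le fun q hq => Nat.le_of_mem_primeFactors hq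
    have key := log_sum (U := x / m) (by positivity) (div_le_self hx0.le hm1) (by linarith) hQ
      (G.image g) (by
        intro r hr
        obtain ⟨n, hn, rfl⟩ := Finset.mem_image.1 hr
        obtain ⟨hn1, rfl⟩ := Finset.mem_filter.1 hn
        obtain ⟨a, b, c, d⟩ := hpos n hn1
        refine ⟨by exact_mod_cast b.ne', ?_, hg n hn1⟩
        rw [le_div_iff₀ hm0, mul_comm, ← d]
        exact (hD n hn1).2.1)
    rw [Finset.sum_image hinj] at key
    refine key.trans (le_of_eq ?_)
    rw [lQ]; ring
  linarith

lemma PD_count : ∃ C : ℝ, 0 < C ∧ ∀ X Z : ℝ, 2 ≤ Z → Z ≤ X → ∀ D : Finset ℕ,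
    (∀ n ∈ D, PD Z n ∧ (n : ℝ) ≤ X) → (D.card : ℝ) ≤ C * X * Real.log Z / Real.log X := by
  classical
  obtain ⟨C, hC, hW⟩ := WW_bound
  have hl4 : 0 < Real.log 4 := Real.log_pos (by norm_num)
  set A := (Real.log 4 + 4) * (8 * Real.exp 200) with hA
  have hA0 : 0 < A := by positivity
  refine ⟨20 + 4 * A * C, by positivity, fun X Z hZ hZX D hD => ?_⟩
  have hX2 : 2 ≤ X := hZ.trans hZX
  have hlX : 0 < Real.log X := Real.log_pos (by linarith)
  have hl2 := Real.log_two_gt_d9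
  have hlZ : Real.log 2 ≤ Real.log Z := Real.log_le_log (by norm_num) hZ
  have hcount : ∀ Y : ℝ, 0 ≤ Y → ∀ E : Finset ℕ, (∀ n ∈ E, n ≠ 0 ∧ (n : ℝ) ≤ Y) → (E.card : ℝ) ≤ Y := by
    intro Y hY E hE
    have h1 : E ⊆ Finset.Icc 1 ⌊Y⌋₊ := fun n hn => by
      rw [Finset.mem_Icc]
      exact ⟨Nat.one_le_iff_ne_zero.2 (hE n hn).1, Nat.le_floor (hE n hn).2⟩
    have h2 := Finset.card_le_card h1
    rw [Nat.card_Icc, Nat.add_sub_cancel] at h2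
    exact (Nat.cast_le.2 h2).trans (Nat.floor_le hY)
  have hACnn : 0 ≤ 4 * A * C * (X * Real.log Z) := by
    have : 0 < Real.log Z := by linarith
    have : 0 < X := by linarith
    positivity
  rw [le_div_iff₀ hlX]
  by_cases hc : X < 64
  · have h1 := hcount X (by linarith) D fun n hn => ⟨(hD n hn).1.1, (hD n hn).2⟩
    have h2 : Real.log X ≤ 6 * Real.log 2 := by
      have := Real.log_le_log (by linarith) hc.le
      rwa [show (64 : ℝ) = 2 ^ 6 by norm_num, Real.log_pow] at this
    have h3 : (D.card : ℝ) * Real.log X ≤ X * (6 * Real.log Z) :=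
      mul_le_mul h1 (by linarith) hlX.le (by linarith)
    nlinarith
  · push Not at hc
    have hs := Real.sqrt_nonneg X
    have hss := Real.mul_self_sqrt (show 0 ≤ X by linarith)
    set D1 := D.filter (fun n : ℕ => Real.sqrt X < n) with hD1
    set D2 := D.filter (fun n : ℕ => ¬ Real.sqrt X < n) with hD2
    have hcard : D1.card + D2.card = D.card := Finset.card_filter_add_card_filter_not _
    have h2 := hcount _ hs D2 fun n hn => by
      obtain ⟨h1, h2⟩ := Finset.mem_filter.1 hn
      exact ⟨(hD n h1).1.1, not_lt.1 h2⟩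
    have h1 := sum_log_part (Z := Z) (by linarith) hc D1 fun n hn => by
      obtain ⟨h1, h2⟩ := Finset.mem_filter.1 hn
      exact ⟨(hD n h1).1, (hD n h1).2, h2⟩
    have h3 := hW Z (Real.sqrt X) hZ (Real.le_sqrt_of_sq_le (by linarith))
    rw [Real.log_sqrt (by linarith), le_div_iff₀ (by linarith)] at h3
    have h4 : A * X * (Real.log X / 2 * WW Z (Real.sqrt X)) ≤ A * X * (C * Real.log Z) := by
      have : 0 < A * X := by positivity
      refine mul_le_mul_of_nonneg_left (by linarith) this.le
    have h5 : Real.log X ≤ 2 * Real.sqrt X := by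
      have := Real.log_le_sub_one_of_pos (Real.sqrt_pos.2 (show 0 < X by linarith))
      rw [Real.log_sqrt (by linarith)] at this
      linarith
    have h6 : (D2.card : ℝ) * Real.log X ≤ 2 * X := by
      have := mul_le_mul h2 h5 hlX.le hs
      nlinarith
    have h7 : (D.card : ℝ) = D1.card + D2.card := by exact_mod_cast hcard.symm
    have h8 : X * (1 / 2) ≤ X * Real.log Z := mul_le_mul_of_nonneg_left (by linarith) (by linarith)
    rw [h7]
    have h9 : A * X * Real.log X * WW Z (Real.sqrt X) ≤ 2 * (A * X * (C * Real.log Z)) := by linarith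
    have h10 : (D1.card : ℝ) * Real.log X ≤ 8 * X + 4 * (A * X * (C * Real.log Z)) := by linarith
    have h11 : (20 + 4 * A * C) * X * Real.log Z =
      20 * (X * Real.log Z) + 4 * (A * X * (C * Real.log Z)) := by ring
    rw [h11, add_mul]
    linarith

theorem stmt10 :
    ∃ C : ℝ, ∀ X Z : ℝ, 2 ≤ Z → Z ≤ X →
      (Nat.card {n : ℕ | 0 < n ∧ (n : ℝ) ≤ X ∧ ZDense Z n} : ℝ) ≤
        C * X * Real.log Z / Real.log X := by
  obtain ⟨C, _, h⟩ := PD_count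
  refine ⟨C, fun X Z hZ hZX => ?_⟩
  have hfin : {n : ℕ | 0 < n ∧ (n : ℝ) ≤ X ∧ ZDense Z n}.Finite :=
    (Set.finite_Iic ⌊X⌋₊).subset fun n hn => Nat.le_floor hn.2.1
  rw [Nat.card_coe_set_eq, Set.ncard_eq_toFinset_card _ hfin]
  refine h X Z hZ hZX _ fun n hn => ?_
  rw [Set.Finite.mem_toFinset] at hn
  exact ⟨hn.2.2.pd hn.1, hn.2.1⟩
end
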